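/- arXiv:2406.11688 — 9 statements merged into one kernel-verified Lean document; each statement's English description precedes it below -/
import Mathlib

section
/- For every integer k ≥ 1, if f is an independent [k]-Roman dominating function of a finite simple graph G, then no vertex of G receives a label in {1, 2, …, k−1}; that is, f(v) ∈ {0, k, k+1} for every vertex v of G. -/
/-!
Basic definitions for `[k]`-Roman domination on (finite) simple graphs.
-/

namespace KRoman

variable {V : Type*}

/-- `|AN(v)|`: the number of active neighbors of `v` under `f`. -/
noncomputable def activeNbrCard (G : SimpleGraph V) (f : V → ℕ) (v : V) : ℕ :=
  {u | G.Adj v u ∧ 1 ≤ f u}.ncard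

/-- `Σ_{u ∈ N[v]} f(u)`: the sum of `f` over the closed neighborhood of `v`. -/
noncomputable def closedNbhdSum (G : SimpleGraph V) (f : V → ℕ) (v : V) : ℕ :=
  f v + ∑ᶠ u ∈ {u | G.Adj v u}, f u

/-- `f` is a `[k]`-Roman dominating function on `G`. -/
def IsKRDF (G : SimpleGraph V) (k : ℕ) (f : V → ℕ) : Prop :=
  (∀ v, f v ≤ k + 1) ∧
  ∀ v, f v < k → k + activeNbrCard G f v ≤ closedNbhdSum G f v

/-- `f` is an independent `[k]`-Roman dominating function on `G`:
a `[k]`-RDF whose set of active vertices is independent. -/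
def IsKIRDF (G : SimpleGraph V) (k : ℕ) (f : V → ℕ) : Prop :=
  IsKRDF G k f ∧ ∀ u v, G.Adj u v → ¬(1 ≤ f u ∧ 1 ≤ f v)

/-- The weight `ω(f) = Σ_v f(v)` of a labeling. -/
noncomputable def weight (f : V → ℕ) : ℕ := ∑ᶠ v, f v

/-- The `[k]`-Roman domination number `γ_[kR](G)`. -/
noncomputable def gammaKR (G : SimpleGraph V) (k : ℕ) : ℕ :=
  sInf {w | ∃ f : V → ℕ, IsKRDF G k f ∧ weight f = w}

/-- The independent `[k]`-Roman domination number `i_[kR](G)`. -/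
noncomputable def iKR (G : SimpleGraph V) (k : ℕ) : ℕ :=
  sInf {w | ∃ f : V → ℕ, IsKIRDF G k f ∧ weight f = w}

/-- The degree of a vertex. -/
noncomputable def deg (G : SimpleGraph V) (v : V) : ℕ := {u | G.Adj v u}.ncard


/-- If `f` is an independent `[k]`-Roman dominating function of a finite
graph `G` (`k ≥ 1`), then every vertex receives a label in `{0, k, k+1}`. -/
theorem label_of_IsKIRDF {V : Type*} [Finite V] (G : SimpleGraph V) (k : ℕ) (hk : 1 ≤ k)
    (f : V → ℕ) (hf : IsKIRDF G k f) (v : V) :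
    f v = 0 ∨ f v = k ∨ f v = k + 1 := by
  obtain ⟨⟨hle, hdom⟩, hind⟩ := hf
  by_contra hcon
  have h1 := hle v
  have hlt : f v < k := by omega
  have hpos : 1 ≤ f v := by omega
  have h2 := hdom v hlt
  have h3 : ∑ᶠ u ∈ {u | G.Adj v u}, f u = 0 := by
    apply finsum_mem_eq_zero_of_forall_eq_zero
    intro u hu
    have h4 := hind v u hu
    omega
  unfold closedNbhdSum at h2
  rw [h3] at h2
  omega
end KRoman
end

section
/- Let k ≥ 1 be an integer and let G be a connected finite simple graph with at least 3 vertices. Then there exists a [k]-Roman dominating function f of G of minimum weight γ_[kR](G) such that f(v) ≠ k+1 for every leaf vertex v of G (a vertex of degree 1). -/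
/-!
Basic definitions for `[k]`-Roman domination on (finite) simple graphs.
-/

namespace KRoman

variable {V : Type*}

open Classical in
theorem closedNbhdSum_eq {V : Type*} [Fintype V] (G : SimpleGraph V) (f : V → ℕ) (v : V) :
    closedNbhdSum G f v =
      activeNbrCard G f v + (f v + ∑ u ∈ Finset.univ.filter (fun u => G.Adj v u), (f u - 1)) := by
  have h1 : activeNbrCard G f v =
      ∑ u ∈ Finset.univ.filter (fun u => G.Adj v u), (if 1 ≤ f u then 1 else 0) := by
    unfold activeNbrCard
    rw [← Finset.card_filter, Finset.filter_filter, ← Set.ncard_coe_finset]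
    congr 1
    ext u
    simp
  have h2 : ∑ᶠ u ∈ {u | G.Adj v u}, f u = ∑ u ∈ Finset.univ.filter (fun u => G.Adj v u), f u := by
    rw [← finsum_mem_coe_finset]
    simp
  unfold closedNbhdSum
  rw [h1, h2, add_left_comm, ← Finset.sum_add_distrib]
  congr 1
  apply Finset.sum_congr rfl
  intro u _
  split_ifs <;> omega

theorem nbr_of_deg_one {V : Type*} (G : SimpleGraph V) (v : V) (h : deg G v = 1) :
    ∃ u, ∀ x, G.Adj v x ↔ x = u := by
  obtain ⟨u, hu⟩ := Set.ncard_eq_one.mp h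
  exact ⟨u, fun x => by simpa using Set.ext_iff.mp hu x⟩

theorem support_deg {V : Type*} [Finite V] (G : SimpleGraph V) (hconn : G.Connected)
    (hcard : 3 ≤ Nat.card V) (u v : V) (hv : ∀ x, G.Adj v x ↔ x = u) : deg G u ≠ 1 := by
  intro h
  obtain ⟨w, hw⟩ := nbr_of_deg_one G u h
  have hvw : v = w := (hw v).mp ((hv u).mpr rfl).symm
  subst hvw
  have key : ∀ a b : V, G.Walk a b → (a = u ∨ a = v) → (b = u ∨ b = v) := by
    intro a b p
    induction p with
    | nil => exact id
    | cons hadj _ ih =>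
      intro ha
      apply ih
      rcases ha with rfl | rfl
      · exact Or.inr ((hw _).mp hadj)
      · exact Or.inl ((hv _).mp hadj)
  have hall : (Set.univ : Set V) ⊆ {u, v} := by
    intro b _
    obtain ⟨p⟩ := hconn.preconnected v b
    simpa using key v b p (Or.inr rfl)
  have h1 := Set.ncard_le_ncard hall (Set.toFinite _)
  have h2 : ({u, v} : Set V).ncard ≤ 2 := by
    simpa using Set.ncard_insert_le u {v}
  rw [Set.ncard_univ] at h1
  omega

open Classical in
theorem swap_step {V : Type*} [Finite V] (G : SimpleGraph V) (k : ℕ) (f : V → ℕ)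
    (hf : IsKRDF G k f) (u v : V) (hv : ∀ x, G.Adj v x ↔ x = u) (hfv : f v = k + 1) :
    ∃ g : V → ℕ, IsKRDF G k g ∧ weight g ≤ weight f ∧ g v ≠ k + 1 ∧
      ∀ x, x ≠ u → x ≠ v → g x = f x := by
  have := Fintype.ofFinite V
  have huv : G.Adj v u := (hv u).mpr rfl
  have hne : v ≠ u := huv.ne
  let g : V → ℕ := fun x => if x = v then min (f u) k else if x = u then k + 1 else f x
  have gv : g v = min (f u) k := by simp [g]
  have gu : g u = k + 1 := by simp [g, hne.symm]
  have gx : ∀ x, x ≠ u → x ≠ v → g x = f x := fun x h1 h2 => by simp [g, h1, h2]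
  refine ⟨g, ⟨?_, ?_⟩, ?_, ?_, gx⟩
  · intro x
    have := hf.1 x
    by_cases h1 : x = v
    · subst h1; omega
    by_cases h2 : x = u
    · subst h2; omega
    rw [gx x h2 h1]; exact this
  · intro w hw
    rw [closedNbhdSum_eq]
    have hwu : w ≠ u := by rintro rfl; omega
    by_cases hwv : w = v
    · subst hwv
      have : g u - 1 ≤ ∑ x ∈ Finset.univ.filter (fun x => G.Adj w x), (g x - 1) :=
        Finset.single_le_sum (f := fun x => g x - 1) (fun _ _ => Nat.zero_le _) (by simp [huv])
      omega
    · have hfw := hf.2 w (by rw [← gx w hwu hwv]; exact hw)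
      rw [closedNbhdSum_eq] at hfw
      have : ∑ x ∈ Finset.univ.filter (fun x => G.Adj w x), (f x - 1) ≤
          ∑ x ∈ Finset.univ.filter (fun x => G.Adj w x), (g x - 1) := by
        apply Finset.sum_le_sum
        intro x hx
        have hx' : G.Adj w x := by simpa using hx
        have hxv : x ≠ v := by
          rintro rfl
          exact hwu ((hv w).mp hx'.symm)
        by_cases hxu : x = u
        · subst hxu
          have := hf.1 x
          omega
        · rw [gx x hxu hxv]
      rw [gx w hwu hwv]
      omega
  · unfold weight
    rw [finsum_eq_sum_of_fintype, finsum_eq_sum_of_fintype, ← Equiv.sum_comp (Equiv.swap u v) f]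
    apply Finset.sum_le_sum
    intro x _
    by_cases h1 : x = v
    · subst h1; simp [gv]
    by_cases h2 : x = u
    · subst h2; simp [gu, hfv]
    rw [gx x h2 h1, Equiv.swap_apply_of_ne_of_ne h2 h1]
  · omega

/-- For `k ≥ 1` and a connected graph `G` on at least 3 vertices, there is a
`[k]`-Roman dominating function of minimum weight `γ_[kR](G)` assigning to no leaf the label
`k+1`. -/
theorem exists_gammaKR_function_leaf_ne_top {V : Type*} [Finite V] (G : SimpleGraph V)
    (k : ℕ) (hk : 1 ≤ k) (hconn : G.Connected) (hcard : 3 ≤ Nat.card V) :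
    ∃ f : V → ℕ, IsKRDF G k f ∧ weight f = gammaKR G k ∧
      ∀ v, deg G v = 1 → f v ≠ k + 1 := by
  have hne : {w | ∃ f : V → ℕ, IsKRDF G k f ∧ weight f = w}.Nonempty :=
    ⟨_, fun _ => k + 1, ⟨fun _ => le_rfl, fun _ h => by dsimp only at h; omega⟩, rfl⟩
  have hmin : ∀ g : V → ℕ, IsKRDF G k g → gammaKR G k ≤ weight g :=
    fun g hg => Nat.sInf_le ⟨g, hg, rfl⟩
  obtain ⟨f₀, hf₀, hw₀⟩ := Nat.sInf_mem hne
  have main : ∀ n : ℕ, ∀ f : V → ℕ, IsKRDF G k f → weight f = gammaKR G k →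
      {v | deg G v = 1 ∧ f v = k + 1}.ncard = n →
      ∃ f : V → ℕ, IsKRDF G k f ∧ weight f = gammaKR G k ∧
        ∀ v, deg G v = 1 → f v ≠ k + 1 := by
    intro n
    induction n using Nat.strong_induction_on with
    | _ n ih =>
      intro f hf hw hn
      by_cases hall : ∀ v, deg G v = 1 → f v ≠ k + 1
      · exact ⟨f, hf, hw, hall⟩
      push Not at hall
      obtain ⟨v, hdv, hfv⟩ := hall
      obtain ⟨u, hv⟩ := nbr_of_deg_one G v hdv
      have hdu := support_deg G hconn hcard u v hv
      obtain ⟨g, hg, hgw, hgv, hgx⟩ := swap_step G k f hf u v hv hfv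
      refine ih _ ?_ g hg (le_antisymm (hw ▸ hgw) (hmin g hg)) rfl
      rw [← hn]
      apply Set.ncard_lt_ncard _ (Set.toFinite _)
      refine ⟨?_, fun hsub => hgv (hsub ⟨hdv, hfv⟩).2⟩
      rintro x ⟨hx1, hx2⟩
      have hxu : x ≠ u := by rintro rfl; exact hdu hx1
      have hxv : x ≠ v := by rintro rfl; exact hgv hx2
      exact ⟨hx1, by rw [← hgx x hxu hxv]; exact hx2⟩
  exact main _ f₀ hf₀ hw₀ rfl
end KRoman
end

section
/- Let k ≥ 1 be an integer and let G be a connected finite simple graph with at least 3 vertices. Then there exists a [k]-Roman dominating function f of G of minimum weight γ_[kR](G) such that f(v) ∈ {0, k} for every leaf vertex v of G (a vertex of degree 1). -/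
/-!
Basic definitions for `[k]`-Roman domination on (finite) simple graphs.
-/

namespace KRoman

variable {V : Type*}

open Classical in
/-- Reformulation of the `[k]`-RDF condition using truncated subtraction. -/
lemma isKRDF_iff {V : Type*} [Fintype V] (G : SimpleGraph V) (k : ℕ) (f : V → ℕ) :
    IsKRDF G k f ↔ (∀ v, f v ≤ k + 1) ∧
      ∀ v, f v < k → k ≤ f v + ∑ u ∈ Finset.univ.filter (fun u => G.Adj v u), (f u - 1) := by
  have key : ∀ v, closedNbhdSum G f v =
      activeNbrCard G f v +
        (f v + ∑ u ∈ Finset.univ.filter (fun u => G.Adj v u), (f u - 1)) := by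
    intro v
    have h1 : activeNbrCard G f v =
        ∑ u ∈ Finset.univ.filter (fun u => G.Adj v u), (if 1 ≤ f u then 1 else 0) := by
      rw [activeNbrCard, Set.ncard_eq_toFinset_card', Finset.sum_ite, Finset.sum_const_zero,
        Finset.sum_const, Finset.filter_filter]
      simp
    have h2 : closedNbhdSum G f v =
        f v + ∑ u ∈ Finset.univ.filter (fun u => G.Adj v u), f u := by
      rw [closedNbhdSum, finsum_mem_eq_toFinset_sum]
      congr 2
      ext u
      simp
    have h3 : ∑ u ∈ Finset.univ.filter (fun u => G.Adj v u), f u =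
        ∑ u ∈ Finset.univ.filter (fun u => G.Adj v u), (if 1 ≤ f u then 1 else 0) +
        ∑ u ∈ Finset.univ.filter (fun u => G.Adj v u), (f u - 1) := by
      rw [← Finset.sum_add_distrib]
      refine Finset.sum_congr rfl fun u _ => ?_
      split_ifs <;> omega
    rw [h1, h2, h3]
    omega
  unfold IsKRDF
  refine and_congr_right fun _ => forall_congr' fun v => imp_congr_right fun _ => ?_
  rw [key v]
  omega

/-- In a connected graph on at least three vertices, two adjacent vertices are not both leaves. -/
lemma not_both_leaf {V : Type*} [Finite V] (G : SimpleGraph V) (hconn : G.Connected)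
    (hcard : 3 ≤ Nat.card V) (u v : V) (hv : ∀ w, G.Adj v w ↔ w = u)
    (hu : ∀ w, G.Adj u w ↔ w = v) : False := by
  have hall : ∀ a b, G.Walk a b → (a = u ∨ a = v) → (b = u ∨ b = v) := by
    intro a b p
    induction p with
    | nil => exact id
    | cons h _ ih =>
      intro ha
      apply ih
      rcases ha with rfl | rfl
      · exact Or.inr ((hu _).1 h)
      · exact Or.inl ((hv _).1 h)
  have huniv : (Set.univ : Set V) ⊆ {u, v} := by
    intro b _
    obtain ⟨p⟩ := hconn.preconnected u b
    exact hall u b p (Or.inl rfl)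
  have h1 := Set.ncard_le_ncard huniv (Set.toFinite _)
  have h2 : ({u, v} : Set V).ncard ≤ 2 := by
    have := Set.ncard_insert_le u {v}
    rwa [Set.ncard_singleton] at this
  rw [Set.ncard_univ] at h1
  omega

/-- One repair step at a bad leaf. -/
lemma repair {V : Type*} [Fintype V] (G : SimpleGraph V) (k : ℕ) (f : V → ℕ)
    (hf : IsKRDF G k f) (u v : V) (hv : ∀ w, G.Adj v w ↔ w = u)
    (h0 : f v ≠ 0) (hk : f v ≠ k) :
    ∃ g : V → ℕ, IsKRDF G k g ∧ weight g ≤ weight f ∧ g v = 0 ∧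
      ∀ w, w ≠ u → w ≠ v → g w = f w := by
  classical
  have huv : G.Adj v u := (hv u).2 rfl
  have hne : v ≠ u := huv.ne
  rw [isKRDF_iff] at hf
  obtain ⟨hb, hd⟩ := hf
  have hbig : k + 1 ≤ f v + f u := by
    by_cases hlt : f v < k
    · have := hd v hlt
      have he : Finset.univ.filter (fun w => G.Adj v w) = {u} := by
        ext w; simp [hv]
      rw [he, Finset.sum_singleton] at this
      omega
    · omega
  refine ⟨fun w => if w = u then k + 1 else if w = v then 0 else f w, ?_, ?_, ?_, ?_⟩
  · rw [isKRDF_iff]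
    refine ⟨fun w => ?_, fun w hw => ?_⟩
    · have := hb w
      split_ifs <;> omega
    · by_cases hwu : w = u
      · simp [hwu] at hw
      by_cases hwv : w = v
      · have he : Finset.univ.filter (fun x => G.Adj w x) = {u} := by
          ext x; simp [hwv, hv]
        rw [he, Finset.sum_singleton]
        simp
      · simp only [hwu, hwv, if_false] at hw ⊢
        refine (hd w hw).trans (Nat.add_le_add_left (Finset.sum_le_sum fun x hx => ?_) _)
        have hx' : G.Adj w x := by simpa using hx
        have hxv : x ≠ v := by
          rintro rfl
          exact hwu ((hv w).1 hx'.symm)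
        have := hb x
        split_ifs <;> omega
  · rw [weight, weight, finsum_eq_sum_of_fintype, finsum_eq_sum_of_fintype]
    have hvm : v ∈ Finset.univ.erase u := by simp [hne]
    rw [← Finset.add_sum_erase _ _ (Finset.mem_univ u), ← Finset.add_sum_erase _ _ hvm,
      ← Finset.add_sum_erase _ f (Finset.mem_univ u), ← Finset.add_sum_erase _ f hvm]
    have he : ∑ w ∈ (Finset.univ.erase u).erase v,
        (if w = u then k + 1 else if w = v then 0 else f w) =
        ∑ w ∈ (Finset.univ.erase u).erase v, f w := by
      refine Finset.sum_congr rfl fun w hw => ?_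
      simp only [Finset.mem_erase] at hw
      simp [hw.1, hw.2.1]
    rw [he]
    simp only [if_true, hne, if_false]
    omega
  · simp [hne]
  · intro w h1 h2
    simp [h1, h2]

/-- For `k ≥ 1` and a connected graph `G` on at least 3 vertices, there is a
`[k]`-Roman dominating function of minimum weight `γ_[kR](G)` assigning to every leaf a label
in `{0, k}`. -/
theorem exists_gammaKR_function_leaf_zero_or_k {V : Type*} [Finite V] (G : SimpleGraph V)
    (k : ℕ) (hk : 1 ≤ k) (hconn : G.Connected) (hcard : 3 ≤ Nat.card V) :
    ∃ f : V → ℕ, IsKRDF G k f ∧ weight f = gammaKR G k ∧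
      ∀ v, deg G v = 1 → f v = 0 ∨ f v = k := by
  classical
  have := Fintype.ofFinite V
  have hleaf : ∀ v, deg G v = 1 → ∃ u, ∀ w, G.Adj v w ↔ w = u := by
    intro v hv
    obtain ⟨u, hu⟩ := Set.ncard_eq_one.1 hv
    exact ⟨u, fun w => by simpa using Set.ext_iff.1 hu w⟩
  have hmin : ∀ g : V → ℕ, IsKRDF G k g → gammaKR G k ≤ weight g :=
    fun g hg => Nat.sInf_le ⟨g, hg, rfl⟩
  have main : ∀ n : ℕ, ∀ f : V → ℕ, IsKRDF G k f → weight f = gammaKR G k →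
      {v | deg G v = 1 ∧ f v ≠ 0 ∧ f v ≠ k}.ncard = n →
      ∃ f : V → ℕ, IsKRDF G k f ∧ weight f = gammaKR G k ∧
        ∀ v, deg G v = 1 → f v = 0 ∨ f v = k := by
    intro n
    induction n using Nat.strong_induction_on with
    | _ n ih =>
      intro f hf hw hn
      by_cases hgood : ∀ v, deg G v = 1 → f v = 0 ∨ f v = k
      · exact ⟨f, hf, hw, hgood⟩
      push Not at hgood
      obtain ⟨v, hdv, h0, h1⟩ := hgood
      obtain ⟨u, hu⟩ := hleaf v hdv
      obtain ⟨g, hg, hgw, hgv, hgo⟩ := repair G k f hf u v hu h0 h1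
      refine ih _ ?_ g hg (le_antisymm (hgw.trans hw.le) (hmin g hg)) rfl
      rw [← hn]
      refine Set.ncard_lt_ncard ?_ (Set.toFinite _)
      refine (Set.ssubset_iff_of_subset ?_).2 ⟨v, ⟨hdv, h0, h1⟩, fun h => h.2.1 hgv⟩
      rintro w ⟨hdw, hw0, hw1⟩
      have hwv : w ≠ v := by
        rintro rfl
        exact hw0 hgv
      have hwu : w ≠ u := by
        rintro rfl
        obtain ⟨x, hx⟩ := hleaf w hdw
        have hxv : v = x := (hx v).1 ((hu w).2 rfl).symm
        subst hxv
        exact not_both_leaf G hconn hcard w v hu hx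
      rw [hgo w hwu hwv] at hw0 hw1
      exact ⟨hdw, hw0, hw1⟩
  have hne : {w | ∃ f : V → ℕ, IsKRDF G k f ∧ weight f = w}.Nonempty := by
    refine ⟨_, fun _ => k, ⟨fun v => Nat.le_succ k, fun v hv => absurd hv (lt_irrefl k)⟩, rfl⟩
  obtain ⟨f, hf, hw⟩ := Nat.sInf_mem hne
  exact main _ f hf hw rfl
end KRoman
end

section
/- Let k ≥ 3 be an integer, let G be a 2-connected planar 3-regular finite simple graph, and let F be the graph obtained from G by the gadget construction (replacing every edge of G with the 10-vertex gadget). Then γ_[kR](F) = i_[kR](F) = τ(G) + k·|V(G)| + (3k+2)·|E(G)|, where τ(G) is the vertex covering number of G. -/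
/-!
Basic definitions for `[k]`-Roman domination on (finite) simple graphs.
-/

namespace KRoman

variable {V : Type*}

/-- An orientation of the edges of `G`: a choice, for every edge of `G`, of exactly one of its
two directions. -/
structure Orientation (G : SimpleGraph V) where
  ori : V → V → Prop
  ori_adj : ∀ u v, ori u v → G.Adj u v
  ori_total : ∀ u v, G.Adj u v → ori u v ∨ ori v u
  ori_once : ∀ u v, ori u v → ¬ ori v u

/-- The (oriented) edges of `G` selected by an orientation `O`. -/
abbrev OEdge {G : SimpleGraph V} (O : Orientation G) : Type _ := {p : V × V // O.ori p.1 p.2}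

/-- Vertices of the gadget graph `F`: the original vertices of `G` together with ten new
vertices `x_1^e, …, x_{10}^e` for every edge `e` of `G` (here `x_m^e` is `Sum.inr (e, m-1)`). -/
abbrev GadgetVert {G : SimpleGraph V} (O : Orientation G) : Type _ := V ⊕ (OEdge O × Fin 10)

/-- The pairs `(m-1, m'-1)` such that `x_m^e x_{m'}^e` is an edge of the gadget:
`x_1x_2, x_2x_3, x_3x_4, x_4x_5, x_6x_7, x_7x_8, x_8x_9, x_9x_10, x_2x_7, x_4x_9`. -/
def gadgetPairs : List (Fin 10 × Fin 10) :=
  [(0, 1), (1, 2), (2, 3), (3, 4), (5, 6), (6, 7), (7, 8), (8, 9), (1, 6), (3, 8)]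

/-- The base relation for the gadget graph: for each edge `e = uv` of `G` (oriented as
`(u, v)`), the edge `uv` is replaced by the edges `u x_1^e`, `x_5^e v` and the internal gadget
edges listed in `gadgetPairs`. -/
def gadgetRel {G : SimpleGraph V} (O : Orientation G) :
    GadgetVert O → GadgetVert O → Prop
  | Sum.inl u, Sum.inr (e, j) => (u = e.val.1 ∧ j = 0) ∨ (u = e.val.2 ∧ j = 4)
  | Sum.inr (e, j), Sum.inr (e', j') => e = e' ∧ (j, j') ∈ gadgetPairs
  | _, _ => False

/-- The graph `F` obtained from `G` by replacing every edge with the 10-vertex gadget. -/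
def gadgetGraph {G : SimpleGraph V} (O : Orientation G) : SimpleGraph (GadgetVert O) :=
  SimpleGraph.fromRel (gadgetRel O)

/-- `G` is 2-connected: it has at least 3 vertices and removing any single vertex leaves a
connected graph. -/
def TwoConnected (G : SimpleGraph V) : Prop :=
  3 ≤ Nat.card V ∧ ∀ v : V, (G.induce ({v}ᶜ : Set V)).Connected

/-- The vertex covering number `τ(G)`. -/
noncomputable def tau (G : SimpleGraph V) : ℕ :=
  sInf {n | ∃ S : Set V, (∀ u v, G.Adj u v → u ∈ S ∨ v ∈ S) ∧ S.ncard = n}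

/-- Reformulation of the sum and count conditions over an explicit neighbor finset. -/
theorem cond_iff {W : Type*} (H : SimpleGraph W) (k : ℕ) (f : W → ℕ) (v : W) (s : Finset W)
    (hs : ∀ u, H.Adj v u ↔ u ∈ s) :
    k + activeNbrCard H f v ≤ closedNbhdSum H f v ↔ k ≤ f v + ∑ u ∈ s, (f u - 1) := by
  classical
  have h1 : activeNbrCard H f v = ∑ u ∈ s, (if 1 ≤ f u then 1 else 0) := by
    have : {u | H.Adj v u ∧ 1 ≤ f u} = ((s.filter (fun u => 1 ≤ f u) : Finset W) : Set W) := by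
      ext u; simp [hs]
    rw [activeNbrCard, this, Set.ncard_coe_finset, Finset.card_filter]
  have h2 : closedNbhdSum H f v = f v + ∑ u ∈ s, f u := by
    have : {u | H.Adj v u} = (s : Set W) := by
      ext u; simp [hs]
    rw [closedNbhdSum, this, finsum_mem_coe_finset]
  have h3 : ∑ u ∈ s, f u = ∑ u ∈ s, (f u - 1) + ∑ u ∈ s, (if 1 ≤ f u then 1 else 0) := by
    rw [← Finset.sum_add_distrib]
    refine Finset.sum_congr rfl fun u _ => ?_
    split_ifs <;> omega
  rw [h1, h2, h3]
  omega

/-- The arithmetic heart: lower bound for the weight of a gadget. -/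
theorem gadget_arith_weak (k x1 x2 x3 x4 x5 x6 x7 x8 x9 x10 : ℕ) (hk : 3 ≤ k)
    (h2 : x2 < k → k ≤ x2 + (x1 - 1) + (x3 - 1) + (x7 - 1))
    (h3 : x3 < k → k ≤ x3 + (x2 - 1) + (x4 - 1))
    (h4 : x4 < k → k ≤ x4 + (x3 - 1) + (x5 - 1) + (x9 - 1))
    (h6 : x6 < k → k ≤ x6 + (x7 - 1))
    (h8 : x8 < k → k ≤ x8 + (x7 - 1) + (x9 - 1))
    (h10 : x10 < k → k ≤ x10 + (x9 - 1)) :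
    3 * k + 2 + (x1 - 1) + (x5 - 1) ≤ x1 + x2 + x3 + x4 + x5 + x6 + x7 + x8 + x9 + x10 := by
  have hL : k + 1 ≤ x6 + x7 ∨ (x6 = k ∧ x7 = 0) := by omega
  have hR : k + 1 ≤ x10 + x9 ∨ (x10 = k ∧ x9 = 0) := by omega
  have hM : k + 1 ≤ x2 + x3 + x4 ∨ (x3 = k ∧ x2 = 0 ∧ x4 = 0) := by omega
  have hMk : k ≤ x2 + x3 + x4 := by omega
  have hA : x7 = 0 → x3 = k → x2 = 0 → x1 - 1 + 1 ≤ x1 := by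
    clear h3 h4 h6 h8 h10 hL hR hM hMk
    intro a b c
    have := h2 (by omega)
    omega
  have hB : x9 = 0 → x3 = k → x4 = 0 → x5 - 1 + 1 ≤ x5 := by
    clear h3 h2 h6 h8 h10 hL hR hM hMk hA
    intro a b c
    have := h4 (by omega)
    omega
  clear h2 h3 h4 h6 h10
  have hx1 : x1 - 1 ≤ x1 := Nat.sub_le _ _
  have hx5 : x5 - 1 ≤ x5 := Nat.sub_le _ _
  generalize x1 - 1 = p at *
  generalize x5 - 1 = q at *
  rcases hL with hL | ⟨hL, hL'⟩ <;> rcases hR with hR | ⟨hR, hR'⟩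
  · clear h8 hA hB
    omega
  · clear h8
    rcases hM with hM | ⟨hM, hM', hM''⟩
    · omega
    · have := hB hR' hM hM''
      omega
  · clear h8
    rcases hM with hM | ⟨hM, hM', hM''⟩
    · omega
    · have := hA hL' hM hM'
      omega
  · subst hL' hR'
    have h8' : k ≤ x8 := by omega
    omega

theorem gadget_arith_strong (k a b x1 x2 x3 x4 x5 x6 x7 x8 x9 x10 : ℕ) (hk : 3 ≤ k)
    (ha : a + (x1 - 1) ≤ k) (hb : b + (x5 - 1) ≤ k)
    (h1 : x1 < k → k ≤ x1 + (a - 1) + (x2 - 1))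
    (h2 : x2 < k → k ≤ x2 + (x1 - 1) + (x3 - 1) + (x7 - 1))
    (h3 : x3 < k → k ≤ x3 + (x2 - 1) + (x4 - 1))
    (h4 : x4 < k → k ≤ x4 + (x3 - 1) + (x5 - 1) + (x9 - 1))
    (h5 : x5 < k → k ≤ x5 + (b - 1) + (x4 - 1))
    (h6 : x6 < k → k ≤ x6 + (x7 - 1))
    (h8 : x8 < k → k ≤ x8 + (x7 - 1) + (x9 - 1))
    (h10 : x10 < k → k ≤ x10 + (x9 - 1)) :
    3 * k + 3 + (x1 - 1) + (x5 - 1) ≤ x1 + x2 + x3 + x4 + x5 + x6 + x7 + x8 + x9 + x10 := by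
  have hL : k + 1 ≤ x6 + x7 ∨ (x6 = k ∧ x7 = 0) := by
    clear h1 h2 h3 h4 h5 h8 h10 ha hb
    omega
  have hR : k + 1 ≤ x10 + x9 ∨ (x10 = k ∧ x9 = 0) := by
    clear h1 h2 h3 h4 h5 h8 h6 ha hb
    omega
  have hM : k + 1 ≤ x2 + x3 + x4 ∨ (x3 = k ∧ x2 = 0 ∧ x4 = 0) := by
    clear h1 h2 h4 h5 h8 h6 h10 ha hb hL hR
    omega
  have hA : 1 ≤ x1 ∨ (x1 = 0 ∧ 2 ≤ x2) := by
    clear h2 h3 h4 h5 h8 h6 h10 hb hL hR hM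
    omega
  have hB : 1 ≤ x5 ∨ (x5 = 0 ∧ 2 ≤ x4) := by
    clear h2 h3 h4 h1 h8 h6 h10 ha hL hR hM hA
    omega
  have hMk : k ≤ x2 + x3 + x4 := by
    clear h2 h3 h4 h1 h5 h8 h6 h10 ha hb hL hR hA hB
    omega
  have hAB : 2 ≤ x2 → 2 ≤ x4 → k + 2 ≤ x2 + x3 + x4 := by
    clear h1 h5 ha hb hL hR hM hA hB h2 h4 h6 h8 h10
    omega
  clear h1 h5 ha hb h2 h3 h4 h6 h10
  have hx1 : x1 - 1 ≤ x1 := Nat.sub_le _ _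
  have hx5 : x5 - 1 ≤ x5 := Nat.sub_le _ _
  have hA' : 2 ≤ x2 ∨ x1 - 1 + 1 ≤ x1 := by omega
  have hB' : 2 ≤ x4 ∨ x5 - 1 + 1 ≤ x5 := by omega
  generalize x1 - 1 = p at *
  generalize x5 - 1 = q at *
  clear hA hB
  rcases hL with hL | ⟨hL, hL'⟩ <;> rcases hR with hR | ⟨hR, hR'⟩
  · omega
  · omega
  · omega
  · subst hL' hR'
    have h8' : k ≤ x8 := by omega
    omega

section Gadget

variable {V : Type*} {G : SimpleGraph V} (O : Orientation G)

theorem adj_inr_inr (e e' : OEdge O) (i j : Fin 10) :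
    (gadgetGraph O).Adj (Sum.inr (e, i)) (Sum.inr (e', j)) ↔
      e' = e ∧ ((i, j) ∈ gadgetPairs ∨ (j, i) ∈ gadgetPairs) := by
  have hne : ∀ i j : Fin 10, ((i, j) ∈ gadgetPairs ∨ (j, i) ∈ gadgetPairs) → i ≠ j := by
    decide
  simp only [gadgetGraph, SimpleGraph.fromRel_adj, gadgetRel]
  constructor
  · rintro ⟨-, ⟨h, h'⟩ | ⟨h, h'⟩⟩
    · exact ⟨h.symm, Or.inl h'⟩
    · exact ⟨h, Or.inr h'⟩
  · rintro ⟨rfl, h⟩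
    refine ⟨?_, ?_⟩
    · intro h'
      have := hne i j h
      simp at h'
      exact this h'
    · rcases h with h | h
      · exact Or.inl ⟨rfl, h⟩
      · exact Or.inr ⟨rfl, h⟩

theorem adj_inl_inr (u : V) (e : OEdge O) (j : Fin 10) :
    (gadgetGraph O).Adj (Sum.inl u) (Sum.inr (e, j)) ↔
      (u = e.val.1 ∧ j = 0) ∨ (u = e.val.2 ∧ j = 4) := by
  simp [gadgetGraph, SimpleGraph.fromRel_adj, gadgetRel]

theorem adj_inr_inl (u : V) (e : OEdge O) (j : Fin 10) :
    (gadgetGraph O).Adj (Sum.inr (e, j)) (Sum.inl u) ↔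
      (u = e.val.1 ∧ j = 0) ∨ (u = e.val.2 ∧ j = 4) := by
  rw [SimpleGraph.adj_comm, adj_inl_inr]

theorem not_adj_inl_inl (u v : V) : ¬ (gadgetGraph O).Adj (Sum.inl u) (Sum.inl v) := by
  simp [gadgetGraph, SimpleGraph.fromRel_adj, gadgetRel]

/-- Generic step extracting the inequality at an internal gadget vertex. -/
theorem cond_of_krdf {k : ℕ} {f : GadgetVert O → ℕ} (hf : IsKRDF (gadgetGraph O) k f)
    (v : GadgetVert O) (s : Finset (GadgetVert O))
    (hs : ∀ u, (gadgetGraph O).Adj v u ↔ u ∈ s) (h : f v < k) :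
    k ≤ f v + ∑ u ∈ s, (f u - 1) :=
  (cond_iff _ k f v s hs).1 (hf.2 v h)

theorem gadget_bounds {k : ℕ} (hk : 3 ≤ k) {f : GadgetVert O → ℕ}
    (hf : IsKRDF (gadgetGraph O) k f) (e : OEdge O) :
    3 * k + 2 + (f (Sum.inr (e, 0)) - 1) + (f (Sum.inr (e, 4)) - 1)
        ≤ ∑ j, f (Sum.inr (e, j)) ∧
    (f (Sum.inl e.val.1) + (f (Sum.inr (e, 0)) - 1) ≤ k →
      f (Sum.inl e.val.2) + (f (Sum.inr (e, 4)) - 1) ≤ k →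
      3 * k + 3 + (f (Sum.inr (e, 0)) - 1) + (f (Sum.inr (e, 4)) - 1)
        ≤ ∑ j, f (Sum.inr (e, j))) := by
  classical
  have key : ∀ (i : Fin 10) (s : Finset (GadgetVert O)),
      (∀ u, (gadgetGraph O).Adj (Sum.inr (e, i)) u ↔ u ∈ s) →
      f (Sum.inr (e, i)) < k → k ≤ f (Sum.inr (e, i)) + ∑ u ∈ s, (f u - 1) :=
    fun i s hs => cond_of_krdf O hf _ s hs
  have h1 := key 0 {Sum.inl e.val.1, Sum.inr (e, 1)} (by
    rintro (u | ⟨e', j⟩)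
    · simp [adj_inr_inl]
    · fin_cases j <;> simp [adj_inr_inr, gadgetPairs])
  have h2 := key 1 {Sum.inr (e, 0), Sum.inr (e, 2), Sum.inr (e, 6)} (by
    rintro (u | ⟨e', j⟩)
    · simp [adj_inr_inl]
    · fin_cases j <;> simp [adj_inr_inr, gadgetPairs])
  have h3 := key 2 {Sum.inr (e, 1), Sum.inr (e, 3)} (by
    rintro (u | ⟨e', j⟩)
    · simp [adj_inr_inl]
    · fin_cases j <;> simp [adj_inr_inr, gadgetPairs])
  have h4 := key 3 {Sum.inr (e, 2), Sum.inr (e, 4), Sum.inr (e, 8)} (by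
    rintro (u | ⟨e', j⟩)
    · simp [adj_inr_inl]
    · fin_cases j <;> simp [adj_inr_inr, gadgetPairs])
  have h5 := key 4 {Sum.inl e.val.2, Sum.inr (e, 3)} (by
    rintro (u | ⟨e', j⟩)
    · simp [adj_inr_inl]
    · fin_cases j <;> simp [adj_inr_inr, gadgetPairs])
  have h6 := key 5 {Sum.inr (e, 6)} (by
    rintro (u | ⟨e', j⟩)
    · simp [adj_inr_inl]
    · fin_cases j <;> simp [adj_inr_inr, gadgetPairs])
  have h8 := key 7 {Sum.inr (e, 6), Sum.inr (e, 8)} (by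
    rintro (u | ⟨e', j⟩)
    · simp [adj_inr_inl]
    · fin_cases j <;> simp [adj_inr_inr, gadgetPairs])
  have h10 := key 9 {Sum.inr (e, 8)} (by
    rintro (u | ⟨e', j⟩)
    · simp [adj_inr_inl]
    · fin_cases j <;> simp [adj_inr_inr, gadgetPairs])
  rw [Finset.sum_pair (by simp)] at h1 h3 h5 h8
  rw [Finset.sum_singleton] at h6 h10
  rw [Finset.sum_insert (by simp), Finset.sum_pair (by simp)] at h2 h4
  simp only [← add_assoc] at h1 h2 h3 h4 h5 h6 h8 h10
  have hsum : ∑ j, f (Sum.inr (e, j)) = f (Sum.inr (e, 0)) + f (Sum.inr (e, 1)) +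
      f (Sum.inr (e, 2)) + f (Sum.inr (e, 3)) + f (Sum.inr (e, 4)) + f (Sum.inr (e, 5)) +
      f (Sum.inr (e, 6)) + f (Sum.inr (e, 7)) + f (Sum.inr (e, 8)) + f (Sum.inr (e, 9)) := by
    simp only [Fin.sum_univ_succ, Fin.sum_univ_zero]
    simp only [add_zero, add_assoc]
    rfl
  rw [hsum]
  refine ⟨gadget_arith_weak k _ _ _ _ _ _ _ _ _ _ (by omega) h2 h3 h4 h6 h8 h10, fun ha hb => ?_⟩
  exact gadget_arith_strong k _ _ _ _ _ _ _ _ _ _ _ _ hk ha hb h1 h2 h3 h4 h5 h6 h8 h10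

open Classical in
/-- The inequality at an original vertex. -/
theorem vertex_bound [Fintype V] {k : ℕ} {f : GadgetVert O → ℕ}
    (hf : IsKRDF (gadgetGraph O) k f) (v : V) :
    k ≤ f (Sum.inl v) + ∑ e : OEdge O, ((if v = e.val.1 then f (Sum.inr (e, 0)) - 1 else 0)
      + (if v = e.val.2 then f (Sum.inr (e, 4)) - 1 else 0)) := by
  by_cases h : k ≤ f (Sum.inl v)
  · omega
  have := cond_of_krdf O hf (Sum.inl v)
    (Finset.univ.filter fun u => (gadgetGraph O).Adj (Sum.inl v) u) (by simp) (by omega)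
  rw [Finset.sum_filter, Fintype.sum_sum_type, Fintype.sum_prod_type] at this
  simp only [not_adj_inl_inl, if_false, Finset.sum_const_zero, zero_add, adj_inl_inr] at this
  convert this using 3 with e
  have hne : e.val.1 ≠ e.val.2 := (O.ori_adj _ _ e.2).ne
  simp only [Fin.sum_univ_succ, Fin.sum_univ_zero]
  by_cases h1 : v = e.val.1
  · have h2 : v ≠ e.val.2 := fun h => hne (h1.symm.trans h)
    simp [h1, hne]
  · by_cases h2 : v = e.val.2
    · simp [h2, hne.symm]
    · simp [h1, h2]

theorem card_oedge : Nat.card (OEdge O) = Nat.card G.edgeSet := by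
  refine Nat.card_eq_of_bijective
    (fun e => (⟨s(e.val.1, e.val.2), O.ori_adj _ _ e.2⟩ : G.edgeSet)) ⟨?_, ?_⟩
  · rintro ⟨⟨a, b⟩, h⟩ ⟨⟨c, d⟩, h'⟩ heq
    replace heq : s(a, b) = s(c, d) := congrArg Subtype.val heq
    rw [Sym2.eq_iff] at heq
    rcases heq with ⟨rfl, rfl⟩ | ⟨rfl, rfl⟩
    · rfl
    · exact absurd h' (O.ori_once _ _ h)
  · rintro ⟨z, hz⟩
    induction z with
    | _ a b =>
      rcases O.ori_total a b hz with h | h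
      · exact ⟨⟨(a, b), h⟩, rfl⟩
      · exact ⟨⟨(b, a), h⟩, Subtype.ext Sym2.eq_swap⟩

theorem lower_bound [Finite V] {k : ℕ} (hk : 3 ≤ k) {f : GadgetVert O → ℕ}
    (hf : IsKRDF (gadgetGraph O) k f) :
    tau G + k * Nat.card V + (3 * k + 2) * Nat.card G.edgeSet ≤ weight f := by
  classical
  have := Fintype.ofFinite V
  have := Fintype.ofFinite (OEdge O)
  set p : OEdge O → ℕ := fun e => f (Sum.inr (e, 0)) - 1 with hp
  set q : OEdge O → ℕ := fun e => f (Sum.inr (e, 4)) - 1 with hq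
  set w : OEdge O → ℕ := fun e => ∑ j, f (Sum.inr (e, j)) with hw
  set C : V → ℕ := fun v => f (Sum.inl v) +
    ∑ e : OEdge O, ((if v = e.val.1 then p e else 0) + (if v = e.val.2 then q e else 0)) with hC
  have hCk : ∀ v, k ≤ C v := fun v => by
    convert vertex_bound O hf v
  have hsumC : ∑ v, C v = ∑ v, f (Sum.inl v) + ∑ e, (p e + q e) := by
    simp only [hC, Finset.sum_add_distrib]
    rw [Finset.sum_comm (f := fun v (e : OEdge O) => if v = e.val.1 then p e else 0),
      Finset.sum_comm (f := fun v (e : OEdge O) => if v = e.val.2 then q e else 0)]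
    simp
  have hweight : weight f = ∑ v, f (Sum.inl v) + ∑ e, w e := by
    rw [weight, finsum_eq_sum_of_fintype, Fintype.sum_sum_type, Fintype.sum_prod_type]
  have hloc := fun e => gadget_bounds O hk hf e
  have hC1 : ∀ e : OEdge O, f (Sum.inl e.val.1) + p e ≤ C e.val.1 := fun e => by
    have := Finset.single_le_sum (f := fun e' : OEdge O =>
      (if e.val.1 = e'.val.1 then p e' else 0) + (if e.val.1 = e'.val.2 then q e' else 0))
      (fun _ _ => Nat.zero_le _) (Finset.mem_univ e)
    simp only [if_true] at this
    simp only [hC]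
    omega
  have hC2 : ∀ e : OEdge O, f (Sum.inl e.val.2) + q e ≤ C e.val.2 := fun e => by
    have := Finset.single_le_sum (f := fun e' : OEdge O =>
      (if e.val.2 = e'.val.1 then p e' else 0) + (if e.val.2 = e'.val.2 then q e' else 0))
      (fun _ _ => Nat.zero_le _) (Finset.mem_univ e)
    simp only [if_true] at this
    simp only [hC]
    omega
  set A : Finset V := Finset.univ.filter fun v => k + 1 ≤ C v with hA
  set B : Finset (OEdge O) := Finset.univ.filter fun e => 3 * k + 3 + p e + q e ≤ w e with hB
  have hcover : tau G ≤ A.card + B.card := by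
    have h1 : tau G ≤ ((A ∪ B.image (fun e => e.val.1) : Finset V) : Set V).ncard := by
      refine Nat.sInf_le ⟨_, ?_, rfl⟩
      have aux : ∀ e : OEdge O, e.val.1 ∈ A ∪ B.image (fun e => e.val.1) ∨
          e.val.2 ∈ A ∪ B.image (fun e => e.val.1) := by
        intro e
        by_cases h1 : k + 1 ≤ C e.val.1
        · left; exact Finset.mem_union_left _ (by rw [hA, Finset.mem_filter]; exact ⟨Finset.mem_univ _, h1⟩)
        by_cases h2 : k + 1 ≤ C e.val.2
        · right; exact Finset.mem_union_left _ (by rw [hA, Finset.mem_filter]; exact ⟨Finset.mem_univ _, h2⟩)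
        left
        refine Finset.mem_union_right _ (Finset.mem_image_of_mem (fun e : OEdge O => e.val.1) ?_)
        rw [hB, Finset.mem_filter]
        refine ⟨Finset.mem_univ _, (hloc e).2 ?_ ?_⟩
        · have := hC1 e; simp only [hp] at this ⊢; omega
        · have := hC2 e; simp only [hq] at this ⊢; omega
      intro u v huv
      simp only [Finset.mem_coe]
      rcases O.ori_total u v huv with h | h
      · exact aux ⟨(u, v), h⟩
      · exact (aux ⟨(v, u), h⟩).symm
    rw [Set.ncard_coe_finset] at h1
    exact h1.trans ((Finset.card_union_le _ _).trans
      (Nat.add_le_add_left Finset.card_image_le _))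
  have hsA : k * Fintype.card V + A.card ≤ ∑ v, C v := by
    rw [hA, Finset.card_filter]
    have : k * Fintype.card V = ∑ _v : V, k := by simp [mul_comm]
    rw [this, ← Finset.sum_add_distrib]
    refine Finset.sum_le_sum fun v _ => ?_
    have := hCk v
    split_ifs <;> omega
  have hsB : (3 * k + 2) * Fintype.card (OEdge O) + B.card + ∑ e, (p e + q e) ≤ ∑ e, w e := by
    rw [hB, Finset.card_filter]
    have : (3 * k + 2) * Fintype.card (OEdge O) = ∑ _e : OEdge O, (3 * k + 2) := by
      simp [mul_comm]
    rw [this, ← Finset.sum_add_distrib, ← Finset.sum_add_distrib]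
    refine Finset.sum_le_sum fun e _ => ?_
    have := (hloc e).1
    change 3 * k + 2 + p e + q e ≤ w e at this
    split_ifs <;> omega
  rw [← card_oedge O, Nat.card_eq_fintype_card, Nat.card_eq_fintype_card, hweight]
  omega

/-- If a neighbor of `v` has label `k + 1`, then the condition at `v` holds. -/
theorem cond_of_strong_nbr {W : Type*} [Finite W] (H : SimpleGraph W) (k : ℕ) (f : W → ℕ)
    (v u : W) (huv : H.Adj v u) (hu : k + 1 ≤ f u) :
    k + activeNbrCard H f v ≤ closedNbhdSum H f v := by
  classical
  have := Fintype.ofFinite W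
  rw [cond_iff H k f v (Finset.univ.filter fun u => H.Adj v u) (by simp)]
  have := Finset.single_le_sum (s := Finset.univ.filter fun u => H.Adj v u)
    (f := fun u => f u - 1) (fun _ _ => Nat.zero_le _) (by simpa using huv)
  omega

open Classical in
/-- The optimal function obtained from a vertex cover. -/
noncomputable def coverFun (k : ℕ) (S : Set V) : GadgetVert O → ℕ
  | Sum.inl v => if v ∈ S then k + 1 else k
  | Sum.inr (e, j) => if e.val.1 ∈ S then
      (![0, 0, 0, k + 1, 0, 0, k + 1, 0, 0, k] : Fin 10 → ℕ) j
    else (![0, k + 1, 0, 0, 0, k, 0, 0, k + 1, 0] : Fin 10 → ℕ) j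

theorem coverFun_spec [Finite V] (k : ℕ) (S : Set V)
    (hS : ∀ u v, G.Adj u v → u ∈ S ∨ v ∈ S) :
    IsKIRDF (gadgetGraph O) k (coverFun O k S) := by
  classical
  refine ⟨⟨?_, ?_⟩, ?_⟩
  · rintro (v | ⟨e, j⟩)
    · simp only [coverFun]; split_ifs <;> omega
    · simp only [coverFun]
      split_ifs <;> fin_cases j <;> simp
  · rintro (v | ⟨e, j⟩)
    · simp only [coverFun]; split_ifs <;> omega
    · intro h
      have strong : ∀ u, (gadgetGraph O).Adj (Sum.inr (e, j)) u →
          k + 1 ≤ coverFun O k S u → k + activeNbrCard (gadgetGraph O) (coverFun O k S)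
            (Sum.inr (e, j)) ≤ closedNbhdSum (gadgetGraph O) (coverFun O k S)
            (Sum.inr (e, j)) := fun u => cond_of_strong_nbr _ _ _ _ u
      by_cases he : e.val.1 ∈ S
      · simp only [coverFun, he, if_true] at h
        fin_cases j
        · exact strong (Sum.inl e.val.1) (by simp [adj_inr_inl]) (by simp [coverFun, he])
        · exact strong (Sum.inr (e, 6)) (by simp [adj_inr_inr, gadgetPairs]) (by simp [coverFun, he])
        · exact strong (Sum.inr (e, 3)) (by simp [adj_inr_inr, gadgetPairs]) (by simp [coverFun, he])
        · simp at h
        · exact strong (Sum.inr (e, 3)) (by simp [adj_inr_inr, gadgetPairs]) (by simp [coverFun, he])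
        · exact strong (Sum.inr (e, 6)) (by simp [adj_inr_inr, gadgetPairs]) (by simp [coverFun, he])
        · simp at h
        · exact strong (Sum.inr (e, 6)) (by simp [adj_inr_inr, gadgetPairs]) (by simp [coverFun, he])
        · exact strong (Sum.inr (e, 3)) (by simp [adj_inr_inr, gadgetPairs]) (by simp [coverFun, he])
        · simp at h
      · have he2 : e.val.2 ∈ S := (hS _ _ (O.ori_adj _ _ e.2)).resolve_left he
        simp only [coverFun, he, if_false] at h
        fin_cases j
        · exact strong (Sum.inr (e, 1)) (by simp [adj_inr_inr, gadgetPairs]) (by simp [coverFun, he])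
        · simp at h
        · exact strong (Sum.inr (e, 1)) (by simp [adj_inr_inr, gadgetPairs]) (by simp [coverFun, he])
        · exact strong (Sum.inr (e, 8)) (by simp [adj_inr_inr, gadgetPairs]) (by simp [coverFun, he])
        · exact strong (Sum.inl e.val.2) (by simp [adj_inr_inl]) (by simp [coverFun, he2])
        · simp at h
        · exact strong (Sum.inr (e, 1)) (by simp [adj_inr_inr, gadgetPairs]) (by simp [coverFun, he])
        · exact strong (Sum.inr (e, 8)) (by simp [adj_inr_inr, gadgetPairs]) (by simp [coverFun, he])
        · simp at h
        · exact strong (Sum.inr (e, 8)) (by simp [adj_inr_inr, gadgetPairs]) (by simp [coverFun, he])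
  · have hz : ∀ e : OEdge O, coverFun O k S (Sum.inr (e, 0)) = 0 ∧
        coverFun O k S (Sum.inr (e, 4)) = 0 := by
      intro e
      simp only [coverFun]
      split_ifs <;> simp
    rintro (u | ⟨e, i⟩) (v | ⟨e', j⟩) hadj ⟨h1, h2⟩
    · exact not_adj_inl_inl O u v hadj
    · rw [adj_inl_inr] at hadj
      rcases hadj with ⟨-, rfl⟩ | ⟨-, rfl⟩
      · simp [(hz _).1] at h2
      · simp [(hz _).2] at h2
    · rw [adj_inr_inl] at hadj
      rcases hadj with ⟨-, rfl⟩ | ⟨-, rfl⟩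
      · simp [(hz _).1] at h1
      · simp [(hz _).2] at h1
    · rw [adj_inr_inr] at hadj
      obtain ⟨he', hadj⟩ := hadj
      subst he'
      by_cases he : e'.val.1 ∈ S
      · simp only [coverFun, he, if_true] at h1 h2
        fin_cases i <;> fin_cases j <;> simp [gadgetPairs] at hadj h1 h2
      · simp only [coverFun, he, if_false] at h1 h2
        fin_cases i <;> fin_cases j <;> simp [gadgetPairs] at hadj h1 h2

theorem coverFun_weight [Finite V] (k : ℕ) (S : Set V) :
    weight (coverFun O k S) =
      S.ncard + k * Nat.card V + (3 * k + 2) * Nat.card G.edgeSet := by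
  classical
  have := Fintype.ofFinite V
  have := Fintype.ofFinite (OEdge O)
  rw [weight, finsum_eq_sum_of_fintype, Fintype.sum_sum_type, Fintype.sum_prod_type]
  have h1 : ∑ v, coverFun O k S (Sum.inl v) = S.ncard + k * Fintype.card V := by
    have : ∀ v, coverFun O k S (Sum.inl v) = (if v ∈ S then 1 else 0) + k := by
      intro v; simp only [coverFun]; split_ifs <;> omega
    simp only [this, Finset.sum_add_distrib]
    rw [← Finset.card_filter, ← Set.ncard_coe_finset]
    simp [mul_comm]
  have h2 : ∀ e : OEdge O, ∑ j, coverFun O k S (Sum.inr (e, j)) = 3 * k + 2 := by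
    intro e
    simp only [coverFun]
    split_ifs <;> simp [Fin.sum_univ_succ] <;> ring
  rw [h1, Finset.sum_congr rfl fun e _ => h2 e, ← card_oedge O, Nat.card_eq_fintype_card,
    Nat.card_eq_fintype_card]
  simp [mul_comm]

end Gadget

/-- Let `k ≥ 3`, `G` a 2-connected planar 3-regular graph and `F` the gadget
graph of `G`. Then `γ_[kR](F) = i_[kR](F) = τ(G) + k·|V(G)| + (3k+2)·|E(G)|`. -/
theorem gadget_gammaKR_eq_iKR_eq {V : Type*} [Finite V] (G : SimpleGraph V) (k : ℕ)
    (hk : 3 ≤ k) (hreg : ∀ v, deg G v = 3) (h2c : TwoConnected G) (O : Orientation G) :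
    gammaKR (gadgetGraph O) k
        = tau G + k * Nat.card V + (3 * k + 2) * Nat.card G.edgeSet ∧
    iKR (gadgetGraph O) k
        = tau G + k * Nat.card V + (3 * k + 2) * Nat.card G.edgeSet := by
  obtain ⟨S, hS, hcard⟩ : tau G ∈ {n | ∃ S : Set V, (∀ u v, G.Adj u v → u ∈ S ∨ v ∈ S) ∧
      S.ncard = n} :=
    Nat.sInf_mem ⟨_, Set.univ, fun u v _ => Or.inl (Set.mem_univ u), rfl⟩
  have hspec := coverFun_spec O k S hS
  have hwt := coverFun_weight O k S
  rw [hcard] at hwt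
  constructor
  · refine le_antisymm (Nat.sInf_le ⟨_, hspec.1, hwt⟩) ?_
    refine le_csInf ⟨_, _, hspec.1, hwt⟩ ?_
    rintro w ⟨f, hf, rfl⟩
    exact lower_bound O hk hf
  · refine le_antisymm (Nat.sInf_le ⟨_, hspec, hwt⟩) ?_
    refine le_csInf ⟨_, _, hspec, hwt⟩ ?_
    rintro w ⟨f, hf, rfl⟩
    exact lower_bound O hk hf.1
end KRoman
end

section
/- For every integer k ≥ 1 and every finite simple graph G, k·i(G) ≤ i_[kR](G) ≤ (k+1)·i(G), where i(G) is the independent domination number of G. -/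
/-!
Basic definitions for `[k]`-Roman domination on (finite) simple graphs.
-/

namespace KRoman

variable {V : Type*}

/-- `S` is an independent dominating set of `G`. -/
def IsIndepDomSet (G : SimpleGraph V) (S : Set V) : Prop :=
  (∀ u ∈ S, ∀ v ∈ S, ¬ G.Adj u v) ∧ ∀ v, v ∉ S → ∃ u ∈ S, G.Adj u v

/-- The independent domination number `i(G)`. -/
noncomputable def indepDom (G : SimpleGraph V) : ℕ :=
  sInf {n | ∃ S : Set V, IsIndepDomSet G S ∧ S.ncard = n}

/-- Every finite graph has an independent dominating set. -/
theorem exists_indepDomSet {V : Type*} [Finite V] (G : SimpleGraph V) :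
    ∃ S : Set V, IsIndepDomSet G S := by
  obtain ⟨S, hS⟩ := (Set.toFinite {S : Set V | ∀ u ∈ S, ∀ v ∈ S, ¬ G.Adj u v}).exists_maximal
    ⟨∅, by simp⟩
  have hind : ∀ u ∈ S, ∀ v ∈ S, ¬ G.Adj u v := hS.prop
  refine ⟨S, hind, fun v hv => ?_⟩
  by_contra! hcon
  apply hv
  refine hS.le_of_ge (y := insert v S) ?_ (Set.subset_insert v S) (Set.mem_insert v S)
  rintro a (rfl | ha) b (rfl | hb)
  · exact G.loopless.irrefl _
  · exact fun h => hcon b hb h.symm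
  · exact hcon a ha
  · exact hind a ha b hb

/-- Sum of a constant multiple of an indicator. -/
theorem finsum_ge {V : Type*} [Finite V] (f : V → ℕ) (A : Set V) (k : ℕ)
    (h : ∀ v ∈ A, k ≤ f v) : k * A.ncard ≤ ∑ᶠ v, f v := by
  classical
  have := Fintype.ofFinite V
  rw [finsum_eq_sum_of_fintype, Set.ncard_eq_toFinset_card', mul_comm, ← smul_eq_mul]
  refine (Finset.card_nsmul_le_sum _ f k (by simpa using h)).trans ?_
  exact Finset.sum_le_sum_of_subset (Finset.subset_univ _)

open Classical in
theorem finsum_ite {V : Type*} [Finite V] (A : Set V) (k : ℕ) :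
    ∑ᶠ v, (if v ∈ A then k else 0) = k * A.ncard := by
  have := Fintype.ofFinite V
  rw [finsum_eq_sum_of_fintype, Set.ncard_eq_toFinset_card', ← Finset.sum_filter,
    Finset.sum_const, smul_eq_mul, mul_comm]
  congr 2
  ext; simp

theorem indepDom_of_KIRDF {V : Type*} [Finite V] (G : SimpleGraph V) (k : ℕ) (hk : 1 ≤ k)
    (f : V → ℕ) (hf : IsKIRDF G k f) : k * indepDom G ≤ weight f := by
  obtain ⟨⟨_, h2⟩, h3⟩ := hf
  have hA : IsIndepDomSet G {v | 1 ≤ f v} := by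
    refine ⟨fun u hu v hv h => h3 u v h ⟨hu, hv⟩, fun v hv => ?_⟩
    have hv0 : f v = 0 := by simpa using hv
    by_contra! hcon
    have := h2 v (by omega)
    have hz : ∑ᶠ u ∈ {u | G.Adj v u}, f u = 0 := by
      apply finsum_mem_eq_zero_of_forall_eq_zero
      intro u hu
      by_contra h0
      exact hcon u (Nat.one_le_iff_ne_zero.2 h0) (G.adj_symm hu)
    unfold closedNbhdSum at this
    omega
  have hle : indepDom G ≤ {v | 1 ≤ f v}.ncard := Nat.sInf_le ⟨_, hA, rfl⟩
  refine (Nat.mul_le_mul_left k hle).trans ?_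
  refine finsum_ge f _ k fun v hv => ?_
  by_contra! hlt
  have := h2 v hlt
  have hz : ∑ᶠ u ∈ {u | G.Adj v u}, f u = 0 := by
    apply finsum_mem_eq_zero_of_forall_eq_zero
    intro u hu
    by_contra h0
    exact h3 v u hu ⟨hv, Nat.one_le_iff_ne_zero.2 h0⟩
  unfold closedNbhdSum at this
  omega

open Classical in
theorem KIRDF_of_indepDom {V : Type*} [Finite V] (G : SimpleGraph V) (k : ℕ)
    (S : Set V) (hS : IsIndepDomSet G S) :
    IsKIRDF G k (fun v => if v ∈ S then k + 1 else 0) := by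
  obtain ⟨h1, h2⟩ := hS
  refine ⟨⟨fun v => by dsimp only; split_ifs <;> omega, fun v hv => ?_⟩, fun u v h hh => ?_⟩
  · have hvS : v ∉ S := by
      intro h
      simp [h] at hv
    obtain ⟨u, hu, huv⟩ := h2 v hvS
    have hset : {u | G.Adj v u ∧ 1 ≤ (if u ∈ S then k + 1 else 0)} = {u | G.Adj v u ∧ u ∈ S} := by
      ext w
      by_cases hw : w ∈ S <;> simp [hw]
    have hpos : 0 < {u | G.Adj v u ∧ u ∈ S}.ncard :=
      (Set.ncard_pos (Set.toFinite _)).2 ⟨u, huv.symm, hu⟩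
    have hsum : ∑ᶠ u ∈ {u | G.Adj v u}, (if u ∈ S then k + 1 else 0)
        = (k + 1) * {u | G.Adj v u ∧ u ∈ S}.ncard := by
      rw [← finsum_ite, finsum_mem_def]
      congr 1
      ext w
      by_cases hw : G.Adj v w <;> simp [Set.indicator, hw]
    unfold activeNbrCard closedNbhdSum
    rw [hset, hsum]
    nlinarith [Nat.zero_le (if v ∈ S then k + 1 else 0)]
  · obtain ⟨ha, hb⟩ := hh
    refine h1 u ?_ v ?_ h
    · by_contra hc
      simp [hc] at ha
    · by_contra hc
      simp [hc] at hb

/-- For every integer `k ≥ 1` and finite simple graph `G`,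
`k·i(G) ≤ i_[kR](G) ≤ (k+1)·i(G)`. -/
theorem iKR_bounds {V : Type*} [Finite V] (G : SimpleGraph V) (k : ℕ) (hk : 1 ≤ k) :
    k * indepDom G ≤ iKR G k ∧ iKR G k ≤ (k + 1) * indepDom G := by
  classical
  obtain ⟨S, hS, hcard⟩ : indepDom G ∈ {n | ∃ S : Set V, IsIndepDomSet G S ∧ S.ncard = n} := by
    obtain ⟨S, hS⟩ := exists_indepDomSet G
    exact Nat.sInf_mem ⟨_, S, hS, rfl⟩
  have hf := KIRDF_of_indepDom G k S hS
  constructor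
  · obtain ⟨g, hg, hw⟩ : iKR G k ∈ {w | ∃ f : V → ℕ, IsKIRDF G k f ∧ weight f = w} :=
      Nat.sInf_mem ⟨_, _, hf, rfl⟩
    rw [← hw]
    exact indepDom_of_KIRDF G k hk g hg
  · rw [← hcard, ← finsum_ite]
    refine Nat.sInf_le ⟨_, hf, ?_⟩
    unfold weight
    congr! 2
end KRoman
end

section
/- Let k ≥ 1 be an integer and let G be a connected finite simple graph with at least 2 vertices whose maximum degree Δ(G) satisfies Δ(G) ≥ k. Then i_[kR](G) ≥ |V(G)|·(k+1) / (Δ(G)+1). -/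
/-!
Basic definitions for `[k]`-Roman domination on (finite) simple graphs.
-/

namespace KRoman

variable {V : Type*}

/-- The maximum degree `Δ(G)`. -/
noncomputable def maxDeg (G : SimpleGraph V) : ℕ := sSup {d | ∃ v, deg G v = d}

lemma exists_isKIRDF {V : Type*} [Finite V] (G : SimpleGraph V) (k : ℕ) :
    ∃ f : V → ℕ, IsKIRDF G k f := by
  classical
  have := Fintype.ofFinite V
  obtain ⟨S, hS, hmax⟩ : ∃ S : Finset V, (∀ u ∈ S, ∀ v ∈ S, ¬ G.Adj u v) ∧
      ∀ T : Finset V, (∀ u ∈ T, ∀ v ∈ T, ¬ G.Adj u v) → T.card ≤ S.card := by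
    obtain ⟨S, hS, h⟩ := Finset.exists_max_image
      (Finset.univ.filter fun S : Finset V => ∀ u ∈ S, ∀ v ∈ S, ¬ G.Adj u v) Finset.card
      ⟨∅, by simp⟩
    simp only [Finset.mem_filter, Finset.mem_univ, true_and] at hS h
    exact ⟨S, hS, h⟩
  refine ⟨fun v => if v ∈ S then k + 1 else 0, ⟨fun v => ?_, fun v hv => ?_⟩, ?_⟩
  · dsimp only
    split_ifs <;> omega
  · have hvS : v ∉ S := by
      intro h
      simp [h] at hv
    have hex : ∃ u ∈ S, G.Adj v u := by
      by_contra! hno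
      have := hmax (insert v S) (by
        intro a ha b hb hab
        rcases Finset.mem_insert.1 ha with rfl | ha'
        · rcases Finset.mem_insert.1 hb with rfl | hb
          · exact G.loopless.irrefl _ hab
          · exact hno b hb hab
        · rcases Finset.mem_insert.1 hb with hbv | hb
          · exact hno a ha' (hbv ▸ hab.symm)
          · exact hS a ha' b hb hab)
      rw [Finset.card_insert_of_notMem hvS] at this
      omega
    obtain ⟨w, hwS, hw⟩ := hex
    have h1 : activeNbrCard G (fun v => if v ∈ S then k + 1 else 0) v
        = (Finset.univ.filter fun u => G.Adj v u ∧ u ∈ S).card := by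
      unfold activeNbrCard
      rw [← Set.ncard_coe_finset]
      congr 1
      ext u
      by_cases hu : u ∈ S <;> simp [hu]
    have h2 : closedNbhdSum G (fun v => if v ∈ S then k + 1 else 0) v
        = (Finset.univ.filter fun u => G.Adj v u ∧ u ∈ S).card * (k + 1) := by
      unfold closedNbhdSum
      have : {u | G.Adj v u} = ((Finset.univ.filter fun u => G.Adj v u : Finset V) : Set V) := by
        ext; simp
      rw [this, finsum_mem_coe_finset, ← Finset.sum_filter, Finset.filter_filter]
      simp [hvS]
    rw [h1, h2]
    have hpos : 1 ≤ (Finset.univ.filter fun u => G.Adj v u ∧ u ∈ S).card :=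
      Finset.card_pos.2 ⟨w, by simp [hw, hwS]⟩
    nlinarith
  · rintro u v huv ⟨hu, hv⟩
    have hu' : u ∈ S := by
      by_contra h
      simp [h] at hu
    have hv' : v ∈ S := by
      by_contra h
      simp [h] at hv
    exact hS u hu' v hv' huv

lemma weight_bound {V : Type*} [Finite V] (G : SimpleGraph V) (k : ℕ)
    (hk : 1 ≤ k) (hΔ : k ≤ maxDeg G) (f : V → ℕ) (hf : IsKRDF G k f) :
    Nat.card V * (k + 1) ≤ (maxDeg G + 1) * weight f := by
  classical
  have := Fintype.ofFinite V
  set D := maxDeg G with hD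
  have hdeg : ∀ v, (Finset.univ.filter fun u => G.Adj v u).card ≤ D := by
    intro v
    have h1 : deg G v = (Finset.univ.filter fun u => G.Adj v u).card := by
      unfold deg
      rw [← Set.ncard_coe_finset]
      congr 1
      ext; simp
    rw [← h1]
    exact le_csSup (Set.finite_range (deg G)).bddAbove ⟨v, rfl⟩
  have hw : weight f = ∑ v, f v := finsum_eq_sum_of_fintype f
  have hin : ∀ v, k * (if f v = 0 then 1 else 0) ≤
      ∑ u ∈ Finset.univ.filter (fun u => G.Adj v u), (f u - 1) := by
    intro v
    split_ifs with h0
    swap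
    · simp
    have h := hf.2 v (by omega)
    have h1 : activeNbrCard G f v
        = ∑ u ∈ Finset.univ.filter (fun u => G.Adj v u), (if 1 ≤ f u then 1 else 0) := by
      unfold activeNbrCard
      rw [← Finset.card_filter, Finset.filter_filter, ← Set.ncard_coe_finset]
      congr 1
      ext; simp
    have h2 : closedNbhdSum G f v = ∑ u ∈ Finset.univ.filter (fun u => G.Adj v u), f u := by
      unfold closedNbhdSum
      have : {u | G.Adj v u} = ((Finset.univ.filter fun u => G.Adj v u : Finset V) : Set V) := by
        ext; simp
      rw [this, finsum_mem_coe_finset, h0, zero_add]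
    have h3 : ∑ u ∈ Finset.univ.filter (fun u => G.Adj v u), f u =
        ∑ u ∈ Finset.univ.filter (fun u => G.Adj v u), (f u - 1) +
        ∑ u ∈ Finset.univ.filter (fun u => G.Adj v u), (if 1 ≤ f u then 1 else 0) := by
      rw [← Finset.sum_add_distrib]
      refine Finset.sum_congr rfl fun u _ => ?_
      split_ifs <;> omega
    omega
  have hZ : k * ∑ v, (if f v = 0 then 1 else 0) ≤ D * ∑ u, (f u - 1) := by
    calc k * ∑ v, (if f v = 0 then 1 else 0)
        ≤ ∑ v, ∑ u ∈ Finset.univ.filter (fun u => G.Adj v u), (f u - 1) := by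
          rw [Finset.mul_sum]
          exact Finset.sum_le_sum fun v _ => hin v
      _ = ∑ u, ∑ v ∈ Finset.univ.filter (fun v => G.Adj u v), (f u - 1) := by
          simp only [Finset.sum_filter]
          rw [Finset.sum_comm]
          simp only [G.adj_comm]
      _ ≤ D * ∑ u, (f u - 1) := by
          rw [Finset.mul_sum]
          refine Finset.sum_le_sum fun u _ => ?_
          rw [Finset.sum_const, smul_eq_mul]
          exact Nat.mul_le_mul_right _ (hdeg u)
  have hper : ∀ v, k * (k + 1) + (k + 1) * D * (f v - 1) ≤
      k * (D + 1) * f v + k * (k + 1) * (if f v = 0 then 1 else 0) := by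
    intro v
    have hle := hf.1 v
    rcases Nat.eq_zero_or_pos (f v) with h0 | h0
    · simp [h0]
    · obtain ⟨g, hg⟩ : ∃ g, f v = g + 1 := ⟨f v - 1, by omega⟩
      rw [hg] at hle ⊢
      obtain ⟨c, hc⟩ : ∃ c, k = g + c := ⟨k - g, by omega⟩
      obtain ⟨d, hd⟩ : ∃ d, D = k + d := ⟨D - k, by omega⟩
      simp only [Nat.add_sub_cancel, Nat.add_eq_zero_iff, one_ne_zero, and_false, if_false]
      rw [hd]
      have : 0 ≤ c * d := Nat.zero_le _
      subst hc
      nlinarith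
  have hsum := Finset.sum_le_sum fun v (_ : v ∈ (Finset.univ : Finset V)) => hper v
  rw [Finset.sum_add_distrib, Finset.sum_add_distrib, ← Finset.mul_sum, ← Finset.mul_sum,
    ← Finset.mul_sum, ← Finset.mul_sum, ← hw, Finset.sum_const, smul_eq_mul, Finset.card_univ,
    ← Nat.card_eq_fintype_card] at hsum
  have h5 := Nat.mul_le_mul_left (k + 1) hZ
  refine Nat.le_of_mul_le_mul_left (c := k) ?_ (by omega)
  nlinarith

/-- For `k ≥ 1` and a nontrivial connected graph `G` with `Δ(G) ≥ k`,
`i_[kR](G) ≥ |V(G)|·(k+1)/(Δ(G)+1)`. -/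
theorem iKR_lower_bound_of_maxDeg_ge {V : Type*} [Finite V] (G : SimpleGraph V) (k : ℕ)
    (hk : 1 ≤ k) (hconn : G.Connected) (hcard : 2 ≤ Nat.card V) (hΔ : k ≤ maxDeg G) :
    ((Nat.card V : ℝ) * (k + 1)) / ((maxDeg G : ℝ) + 1) ≤ (iKR G k : ℝ) := by
  have hne : {w | ∃ f : V → ℕ, IsKIRDF G k f ∧ weight f = w}.Nonempty := by
    obtain ⟨f, hf⟩ := exists_isKIRDF G k
    exact ⟨_, f, hf, rfl⟩
  obtain ⟨f, hf, hw⟩ := Nat.sInf_mem hne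
  have h := weight_bound G k hk hΔ f hf.1
  rw [hw] at h
  rw [div_le_iff₀ (by positivity), mul_comm (iKR G k : ℝ)]
  exact_mod_cast h
end KRoman
end

section
/- For all integers k ≥ 1 and p ≥ 1, the independent [k]-Roman domination number of the Cartesian product of the path on 2 vertices with the cycle on 4p vertices equals 2p(k+1): i_[kR](P_2 □ C_{4p}) = 2p(k+1). -/
/-!
Basic definitions for `[k]`-Roman domination on (finite) simple graphs.
-/

namespace KRoman

variable {V : Type*}

/-- The prism over the cycle on `m + 4` vertices. -/
abbrev prism (m : ℕ) : SimpleGraph (Fin 2 × Fin (m + 4)) :=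
  (SimpleGraph.pathGraph 2).boxProd (SimpleGraph.cycleGraph (m + 4))

/-- The explicit neighbourhood in the prism. -/
def nb {m : ℕ} (v : Fin 2 × Fin (m + 4)) : Finset (Fin 2 × Fin (m + 4)) :=
  {(v.1 + 1, v.2), (v.1, v.2 + 1), (v.1, v.2 - 1)}

lemma prism_adj {m : ℕ} (v u : Fin 2 × Fin (m + 4)) :
    (prism m).Adj v u ↔ u ∈ nb v := by
  obtain ⟨r, i⟩ := v
  obtain ⟨s, j⟩ := u
  have hc : (SimpleGraph.cycleGraph (m + 4)).Adj i j ↔ (j = i + 1 ∨ j = i - 1) := by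
    refine (SimpleGraph.cycleGraph_adj (n := m + 2)).trans ?_
    constructor
    · rintro (h | h)
      · right; rw [← h]; abel
      · left; rw [← h]; abel
    · rintro (h | h)
      · right; rw [h]; abel
      · left; rw [h]; abel
  have hq : (SimpleGraph.pathGraph 2).Adj r s ↔ s = r + 1 := by
    rw [SimpleGraph.pathGraph_adj]
    fin_cases r <;> fin_cases s <;> simp
  rw [SimpleGraph.boxProd_adj, hc, hq]
  simp only [nb, Finset.mem_insert, Finset.mem_singleton, Prod.mk.injEq]
  constructor
  · rintro (⟨h1, h2⟩ | ⟨h1 | h1, h2⟩)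
    · exact Or.inl ⟨h1, h2.symm⟩
    · exact Or.inr (Or.inl ⟨h2.symm, h1⟩)
    · exact Or.inr (Or.inr ⟨h2.symm, h1⟩)
  · rintro (⟨h1, h2⟩ | ⟨h1, h2⟩ | ⟨h1, h2⟩)
    · exact Or.inl ⟨h1, h2.symm⟩
    · exact Or.inr ⟨Or.inl h2, h1.symm⟩
    · exact Or.inr ⟨Or.inr h2, h1.symm⟩

lemma nb_sum {m : ℕ} (v : Fin 2 × Fin (m + 4)) (g : Fin 2 × Fin (m + 4) → ℕ) :
    ∑ u ∈ nb v, g u = g (v.1 + 1, v.2) + g (v.1, v.2 + 1) + g (v.1, v.2 - 1) := by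
  obtain ⟨r, i⟩ := v
  have hr : r + 1 ≠ r := by fin_cases r <;> simp
  have hi : i + 1 ≠ i - 1 := by
    intro h
    have h2 : (1 : Fin (m + 4)) + 1 = 0 := by
      have : (1 : Fin (m + 4)) + 1 = (i + 1) - (i - 1) := by abel
      rw [this, h, sub_self]
    have h3 := congrArg Fin.val h2
    rw [Fin.val_add] at h3
    simp only [Fin.val_one, Fin.val_zero] at h3
    rw [Nat.mod_eq_of_lt (by omega)] at h3
    omega
  unfold nb
  rw [Finset.sum_insert, Finset.sum_insert, Finset.sum_singleton, add_assoc]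
  · simp [hi]
  · simp [hr]

lemma closed_eq {m : ℕ} (f : Fin 2 × Fin (m + 4) → ℕ) (v : Fin 2 × Fin (m + 4)) :
    closedNbhdSum (prism m) f v = f v + ∑ u ∈ nb v, f u := by
  unfold closedNbhdSum
  have : {u | (prism m).Adj v u} = ((nb v : Finset _) : Set _) := by
    ext u; exact (prism_adj v u).trans Finset.mem_coe.symm
  rw [this, finsum_mem_coe_finset]

lemma active_eq {m : ℕ} (f : Fin 2 × Fin (m + 4) → ℕ) (v : Fin 2 × Fin (m + 4)) :
    activeNbrCard (prism m) f v = ∑ u ∈ nb v, if 1 ≤ f u then 1 else 0 := by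
  unfold activeNbrCard
  have : {u | (prism m).Adj v u ∧ 1 ≤ f u}
      = (((nb v).filter (fun u => 1 ≤ f u) : Finset _) : Set _) := by
    ext u
    rw [Finset.mem_coe, Finset.mem_filter, ← prism_adj]; rfl
  rw [this, Set.ncard_coe_finset, Finset.card_filter]

/-- Twelve times the charge a vertex of label `x` sends to each neighbour. -/
def share (k x : ℕ) : ℕ := if x = 0 then 0 else if x = k then 3 * k - 1 else 3 * (k + 1)

/-- Twelve times the charge a vertex of label `x` keeps. -/
def own (k x : ℕ) : ℕ := if x = 0 then 0 else 3 * (k + 1)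

lemma share_ineq {k a b c : ℕ} (hk : 1 ≤ k) (ha : a = 0 ∨ a = k ∨ a = k + 1)
    (hb : b = 0 ∨ b = k ∨ b = k + 1) (hc : c = 0 ∨ c = k ∨ c = k + 1)
    (h : k + ((if 1 ≤ a then 1 else 0) + (if 1 ≤ b then 1 else 0) + (if 1 ≤ c then 1 else 0))
      ≤ a + b + c) :
    3 * (k + 1) ≤ share k a + share k b + share k c := by
  have s0 : share k 0 = 0 := by simp [share]
  have s1 : share k k = 3 * k - 1 := by
    unfold share; rw [if_neg (by omega), if_pos rfl]
  have s2 : share k (k + 1) = 3 * (k + 1) := by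
    unfold share; rw [if_neg (by omega), if_neg (by omega)]
  rcases ha with rfl | ha | rfl <;> rcases hb with rfl | hb | rfl <;>
    rcases hc with rfl | hc | rfl <;> (try subst ha) <;> (try subst hb) <;> (try subst hc) <;>
    simp only [s0, s1, s2] <;> split_ifs at h <;> omega

lemma lower {m k : ℕ} (hk : 1 ≤ k) (f : Fin 2 × Fin (m + 4) → ℕ)
    (hf : IsKIRDF (prism m) k f) : 2 * (m + 4) * (k + 1) ≤ 4 * weight f := by
  obtain ⟨⟨hle, hdom⟩, hind⟩ := hf
  have hval : ∀ v, f v = 0 ∨ f v = k ∨ f v = k + 1 := by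
    intro v
    by_contra hcon
    have h1 := hdom v (by have := hle v; omega)
    rw [closed_eq] at h1
    have h2 : ∑ u ∈ nb v, f u = 0 := by
      apply Finset.sum_eq_zero
      intro u hu
      have := hind v u ((prism_adj v u).2 hu)
      omega
    have := hle v
    omega
  have hcharge : ∀ v, 12 * f v = own k (f v) + 3 * share k (f v) := by
    intro v
    unfold own share
    rcases hval v with h | h | h <;> rw [h]
    · simp
    · rw [if_neg (by omega), if_neg (by omega), if_pos rfl]; omega
    · rw [if_neg (by omega), if_neg (by omega), if_neg (by omega)]; omega
  have hloc : ∀ v, 3 * (k + 1) ≤ own k (f v) + ∑ u ∈ nb v, share k (f u) := by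
    intro v
    rcases Nat.eq_zero_or_pos (f v) with h0 | h0
    · have h1 := hdom v (by omega)
      rw [closed_eq, active_eq, nb_sum, nb_sum, h0] at h1
      rw [nb_sum]
      have := share_ineq hk (hval (v.1 + 1, v.2)) (hval (v.1, v.2 + 1)) (hval (v.1, v.2 - 1))
        (by omega)
      omega
    · unfold own
      rw [if_neg (by omega)]; omega
  have hsum := Finset.sum_le_sum (fun v (_ : v ∈ Finset.univ) => hloc v)
  have hr1 : ∑ v : Fin 2 × Fin (m + 4), share k (f (v.1 + 1, v.2)) = ∑ v, share k (f v) :=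
    Equiv.sum_comp ((Equiv.addRight (1 : Fin 2)).prodCongr (Equiv.refl (Fin (m + 4))))
      (fun v => share k (f v))
  have hr2 : ∑ v : Fin 2 × Fin (m + 4), share k (f (v.1, v.2 + 1)) = ∑ v, share k (f v) :=
    Equiv.sum_comp ((Equiv.refl (Fin 2)).prodCongr (Equiv.addRight (1 : Fin (m + 4))))
      (fun v => share k (f v))
  have hr3 : ∑ v : Fin 2 × Fin (m + 4), share k (f (v.1, v.2 - 1)) = ∑ v, share k (f v) :=
    Equiv.sum_comp ((Equiv.refl (Fin 2)).prodCongr (Equiv.subRight (1 : Fin (m + 4))))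
      (fun v => share k (f v))
  simp only [nb_sum, Finset.sum_add_distrib, hr1, hr2, hr3] at hsum
  have hw : 12 * weight f = ∑ v, own k (f v) + 3 * ∑ v, share k (f v) := by
    unfold weight
    rw [finsum_eq_sum_of_fintype, Finset.mul_sum, Finset.mul_sum, ← Finset.sum_add_distrib]
    exact Finset.sum_congr rfl (fun v _ => hcharge v)
  simp only [Finset.sum_const, Finset.card_univ, Fintype.card_prod, Fintype.card_fin,
    smul_eq_mul] at hsum
  nlinarith

/-- The extremal labelling. -/
def opt (k n : ℕ) (v : Fin 2 × Fin n) : ℕ :=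
  if v.2.val % 4 = 2 * v.1.val then k + 1 else 0

lemma sum_mod (c a : ℕ) (ha : a < 4) (p : ℕ) :
    ∑ i ∈ Finset.range (4 * p), (if i % 4 = a then c else 0) = p * c := by
  induction p with
  | zero => simp
  | succ p ih =>
    rw [show 4 * (p + 1) = 4 * p + 1 + 1 + 1 + 1 by ring]
    simp only [Finset.sum_range_succ, ih]
    have e0 : (4 * p) % 4 = 0 := by omega
    have e1 : (4 * p + 1) % 4 = 1 := by omega
    have e2 : (4 * p + 1 + 1) % 4 = 2 := by omega
    have e3 : (4 * p + 1 + 1 + 1) % 4 = 3 := by omega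
    rw [e0, e1, e2, e3]
    interval_cases a <;> simp <;> ring

lemma opt_weight (k p : ℕ) : weight (opt k (4 * p)) = 2 * p * (k + 1) := by
  unfold weight
  rw [finsum_eq_sum_of_fintype, Fintype.sum_prod_type, Fin.sum_univ_two]
  unfold opt
  have h0 := Fin.sum_univ_eq_sum_range (fun i => if i % 4 = 0 then k + 1 else 0) (4 * p)
  have h2 := Fin.sum_univ_eq_sum_range (fun i => if i % 4 = 2 then k + 1 else 0) (4 * p)
  rw [sum_mod _ _ (by norm_num)] at h0 h2
  simp only [Fin.val_zero, Fin.val_one, mul_zero, mul_one]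
  rw [h0, h2]; ring

lemma opt_isKIRDF (k m : ℕ) (hm : 4 ∣ m + 4) : IsKIRDF (prism m) k (opt k (m + 4)) := by
  have s1 : ∀ i : Fin (m + 4), (i + 1).val % 4 = (i.val + 1) % 4 := by
    intro i
    rw [Fin.val_add, Nat.mod_mod_of_dvd _ hm, Fin.val_one]
  have s2 : ∀ i : Fin (m + 4), (i - 1).val % 4 = (i.val + 3) % 4 := by
    intro i
    have := s1 (i - 1)
    rw [sub_add_cancel] at this
    omega
  have sr : ∀ r : Fin 2, (r + 1).val = 1 - r.val := by
    intro r; fin_cases r <;> rfl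
  refine ⟨⟨?_, ?_⟩, ?_⟩
  · intro v; unfold opt; split_ifs <;> omega
  · intro v hv
    have hv0 : ¬ (v.2.val % 4 = 2 * v.1.val) := by
      intro h
      unfold opt at hv
      rw [if_pos h] at hv
      omega
    have hlt := v.1.isLt
    rw [closed_eq, active_eq, nb_sum, nb_sum]
    unfold opt
    simp only [s1, s2, sr]
    split_ifs <;> omega
  · intro u v huv
    rw [prism_adj] at huv
    have hlt := u.1.isLt
    simp only [nb, Finset.mem_insert, Finset.mem_singleton] at huv
    unfold opt
    rcases huv with h | h | h <;> rw [h] <;> simp only [s1, s2, sr] <;> split_ifs <;> omega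

/-- For all `k ≥ 1` and `p ≥ 1`,
`i_[kR](P₂ □ C_{4p}) = 2p(k+1)`. -/
theorem iKR_pathGraph_boxProd_cycleGraph (k p : ℕ) (hk : 1 ≤ k) (hp : 1 ≤ p) :
    iKR ((SimpleGraph.pathGraph 2).boxProd (SimpleGraph.cycleGraph (4 * p))) k
      = 2 * p * (k + 1) := by
  obtain ⟨q, rfl⟩ : ∃ q, p = q + 1 := ⟨p - 1, by omega⟩
  have hmem : 2 * (q + 1) * (k + 1) ∈ {w | ∃ f : Fin 2 × Fin (4 * (q + 1)) → ℕ,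
      IsKIRDF ((SimpleGraph.pathGraph 2).boxProd (SimpleGraph.cycleGraph (4 * (q + 1)))) k f
        ∧ weight f = w} :=
    ⟨opt k (4 * (q + 1)), opt_isKIRDF k (4 * q) ⟨q + 1, by ring⟩, opt_weight k (q + 1)⟩
  apply le_antisymm
  · exact Nat.sInf_le hmem
  · apply le_csInf ⟨_, hmem⟩
    rintro w ⟨f, hf, rfl⟩
    have := lower (m := 4 * q) hk f hf
    have h2 : 2 * (4 * q + 4) * (k + 1) = 4 * (2 * (q + 1) * (k + 1)) := by ring
    rw [h2] at this
    exact Nat.le_of_mul_le_mul_left this (by norm_num)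
end KRoman
end

section
/- Let k ≥ 2 be an integer and let G be a 3-regular finite simple graph with n vertices. If f is an independent [k]-Roman dominating function of G of minimum weight i_[kR](G), and V_k, V_{k+1} denote the sets of vertices with labels k and k+1 respectively, then |V_k| ≤ (8·i_[kR](G) − 2(k+1)n) / (3k−5) and |V_{k+1}| ≥ (2kn − 5·i_[kR](G)) / (3k−5). -/
/-!
Basic definitions for `[k]`-Roman domination on (finite) simple graphs.
-/

namespace KRoman

variable {V : Type*}

/-- Let `k ≥ 2` and `G` a 3-regular graph on `n` vertices. If `f` is an
independent `[k]`-Roman dominating function of minimum weight `i_[kR](G)`, then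
`|V_k| ≤ (8·i_[kR](G) − 2(k+1)n)/(3k−5)` and `|V_{k+1}| ≥ (2kn − 5·i_[kR](G))/(3k−5)`. -/
theorem card_Vk_bounds_of_cubic {V : Type*} [Finite V] (G : SimpleGraph V) (k : ℕ)
    (hk : 2 ≤ k) (hreg : ∀ v, deg G v = 3) (f : V → ℕ) (hf : IsKIRDF G k f)
    (hmin : weight f = iKR G k) :
    ({v | f v = k}.ncard : ℝ) ≤
      (8 * (iKR G k : ℝ) - 2 * ((k : ℝ) + 1) * (Nat.card V : ℝ)) / (3 * (k : ℝ) - 5) ∧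
    (2 * (k : ℝ) * (Nat.card V : ℝ) - 5 * (iKR G k : ℝ)) / (3 * (k : ℝ) - 5) ≤
      ({v | f v = k + 1}.ncard : ℝ) := by
  classical
  haveI := Fintype.ofFinite V
  obtain ⟨⟨hle, hdom⟩, hind⟩ := hf
  have hset : ∀ v, {u | G.Adj v u} = ((Finset.univ.filter (fun u => G.Adj v u) : Finset V) : Set V) := by
    intro v; ext u; simp
  have hact : ∀ v, activeNbrCard G f v =
      ∑ u ∈ Finset.univ.filter (fun u => G.Adj v u), if 1 ≤ f u then 1 else 0 := by
    intro v
    have h : {u | G.Adj v u ∧ 1 ≤ f u} =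
        (((Finset.univ.filter (fun u => G.Adj v u)).filter (fun u => 1 ≤ f u) : Finset V) : Set V) := by
      ext u; simp
    rw [activeNbrCard, h, Set.ncard_coe_finset, Finset.card_filter]
  have hsum : ∀ v, closedNbhdSum G f v =
      f v + ∑ u ∈ Finset.univ.filter (fun u => G.Adj v u), f u := by
    intro v
    rw [closedNbhdSum, hset v, finsum_mem_coe_finset]
  have hdeg : ∀ v, (Finset.univ.filter (fun u => G.Adj v u)).card = 3 := by
    intro v
    have := hreg v
    rwa [deg, hset v, Set.ncard_coe_finset] at this
  have hlab : ∀ v, f v = 0 ∨ f v = k ∨ f v = k + 1 := by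
    intro v
    by_contra hcon
    have h1 := hle v
    have h2 := hdom v (by omega)
    rw [hsum] at h2
    have h3 : ∑ u ∈ Finset.univ.filter (fun u => G.Adj v u), f u = 0 := by
      apply Finset.sum_eq_zero
      intro u hu
      have := hind v u (by simpa using hu)
      omega
    omega
  let g : V → ℕ := fun u => if f u = k + 1 then 2 else if f u = k then 1 else 0
  let c : V → ℕ := fun u => if f u = k + 1 then 2 else if f u = k then 2 else 0
  have hloc : ∀ v, 2 ≤ ∑ u ∈ Finset.univ.filter (fun u => G.Adj v u), g u + c v := by
    intro v
    by_cases h0 : f v = 0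
    · by_cases hex : ∃ u, G.Adj v u ∧ f u = k + 1
      · obtain ⟨u, hu, hfu⟩ := hex
        have h1 : g u ≤ ∑ u ∈ Finset.univ.filter (fun u => G.Adj v u), g u :=
          Finset.single_le_sum (fun _ _ => Nat.zero_le _) (by simpa using hu)
        have h2 : g u = 2 := by simp [g, hfu]
        omega
      · push Not at hex
        have h1 := hdom v (by omega)
        rw [hsum, hact, h0] at h1
        have h2 : ∑ u ∈ Finset.univ.filter (fun u => G.Adj v u), f u =
            k * ∑ u ∈ Finset.univ.filter (fun u => G.Adj v u), g u := by
          rw [Finset.mul_sum]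
          apply Finset.sum_congr rfl
          intro u hu
          have hne := hex u (by simpa using hu)
          rcases hlab u with h | h | h
          · simp [g, h]
          · simp [g, h]
          · exact absurd h hne
        have h3 : ∑ u ∈ Finset.univ.filter (fun u => G.Adj v u), (if 1 ≤ f u then 1 else 0) =
            ∑ u ∈ Finset.univ.filter (fun u => G.Adj v u), g u := by
          apply Finset.sum_congr rfl
          intro u hu
          have hne := hex u (by simpa using hu)
          rcases hlab u with h | h | h
          · simp [g, h]; omega
          · simp [g, h]; omega
          · exact absurd h hne
        rw [h2, h3] at h1
        generalize ∑ u ∈ Finset.univ.filter (fun u => G.Adj v u), g u = S at h1 ⊢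
        by_contra hS
        have : S = 0 ∨ S = 1 := by omega
        rcases this with rfl | rfl <;> omega
    · have : c v = 2 := by
        rcases hlab v with h | h | h
        · exact absurd h h0
        · simp [c, h]
        · simp [c, h]
      omega
  have htot := Finset.sum_le_sum (s := Finset.univ) (fun v _ => hloc v)
  have hdc : ∑ v, ∑ u ∈ Finset.univ.filter (fun u => G.Adj v u), g u = ∑ u, 3 * g u := by
    simp_rw [Finset.sum_filter]
    rw [Finset.sum_comm]
    apply Finset.sum_congr rfl
    intro u _
    rw [← Finset.sum_filter, Finset.sum_const, smul_eq_mul, ← hdeg u]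
    simp_rw [G.adj_comm]
  have ha : {v | f v = k}.ncard = ∑ v, if f v = k then 1 else 0 := by
    rw [← Finset.card_filter, ← Set.ncard_coe_finset]; simp
  have hb : {v | f v = k + 1}.ncard = ∑ v, if f v = k + 1 then 1 else 0 := by
    rw [← Finset.card_filter, ← Set.ncard_coe_finset]; simp
  have hgc : ∑ u, 3 * g u + ∑ v, c v = 5 * {v | f v = k}.ncard + 8 * {v | f v = k + 1}.ncard := by
    rw [ha, hb, Finset.mul_sum, Finset.mul_sum, ← Finset.sum_add_distrib, ← Finset.sum_add_distrib]
    apply Finset.sum_congr rfl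
    intro u _
    rcases hlab u with h | h | h
    · have : 0 ≠ k := by omega
      simp [g, c, h, this]
    · simp [g, c, h]
    · simp [g, c, h]
  have hw : weight f = k * {v | f v = k}.ncard + (k + 1) * {v | f v = k + 1}.ncard := by
    rw [weight, finsum_eq_sum_of_fintype, ha, hb, Finset.mul_sum, Finset.mul_sum,
      ← Finset.sum_add_distrib]
    apply Finset.sum_congr rfl
    intro u _
    rcases hlab u with h | h | h
    · have : 0 ≠ k := by omega
      simp [h, this]
    · simp [h]
    · simp [h]
  rw [Finset.sum_add_distrib, hdc, hgc, Finset.sum_const, smul_eq_mul, Finset.card_univ,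
    ← Nat.card_eq_fintype_card] at htot
  rw [← hmin, hw]
  have hT : (Nat.card V : ℝ) * 2 ≤ 5 * ({v | f v = k}.ncard : ℝ) + 8 * ({v | f v = k + 1}.ncard : ℝ) := by
    exact_mod_cast htot
  have hk' : (2 : ℝ) ≤ k := by exact_mod_cast hk
  have hpos : (0 : ℝ) < 3 * (k : ℝ) - 5 := by linarith
  push_cast
  constructor
  · rw [le_div_iff₀ hpos]
    nlinarith [mul_le_mul_of_nonneg_left hT (by linarith : (0 : ℝ) ≤ (k : ℝ) + 1)]
  · rw [div_le_iff₀ hpos]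
    nlinarith [mul_le_mul_of_nonneg_left hT (by linarith : (0 : ℝ) ≤ (k : ℝ))]
end KRoman
end

section
/- Let k ≥ 1 be an integer and G a finite simple graph. For any independent [k]-Roman dominating function f of G of minimum weight i_[kR](G), with V_k and V_{k+1} the sets of vertices labeled k and k+1 respectively, one has |V_{k+1}| ≤ i_[kR](G) − k·i(G) and |V_k| ≥ (k+1)·i(G) − i_[kR](G). -/
/-!
Basic definitions for `[k]`-Roman domination on (finite) simple graphs.
-/

namespace KRoman

variable {V : Type*}

/-- For `k ≥ 1` and any independent `[k]`-Roman dominating function `f` of a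
finite graph `G` of minimum weight `i_[kR](G)`, one has `|V_{k+1}| ≤ i_[kR](G) − k·i(G)` and
`|V_k| ≥ (k+1)·i(G) − i_[kR](G)`. -/
theorem card_Vk_bounds_of_indepDom {V : Type*} [Finite V] (G : SimpleGraph V) (k : ℕ)
    (hk : 1 ≤ k) (f : V → ℕ) (hf : IsKIRDF G k f) (hmin : weight f = iKR G k) :
    (({v | f v = k + 1}.ncard : ℤ) ≤ (iKR G k : ℤ) - (k : ℤ) * (indepDom G : ℤ)) ∧
    (((k : ℤ) + 1) * (indepDom G : ℤ) - (iKR G k : ℤ) ≤ ({v | f v = k}.ncard : ℤ)) := by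
  classical
  have := Fintype.ofFinite V
  obtain ⟨⟨hle, hdom⟩, hind⟩ := hf
  have hlab : ∀ v, 1 ≤ f v → k ≤ f v := by
    intro v hv
    by_contra hlt
    have h := hdom v (by omega)
    have h0 : ∑ᶠ u ∈ {u | G.Adj v u}, f u = 0 := by
      apply finsum_mem_eq_zero_of_forall_eq_zero
      intro u hu
      by_contra hne
      exact hind v u hu ⟨hv, by omega⟩
    unfold closedNbhdSum at h
    omega
  have hS : IsIndepDomSet G {v | 1 ≤ f v} := by
    refine ⟨fun u hu v hv huv => hind u v huv ⟨hu, hv⟩, ?_⟩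
    intro v hv
    have hv0 : f v = 0 := by
      simp only [Set.mem_ofPred_eq] at hv
      omega
    by_contra hno
    have h := hdom v (by omega)
    have h0 : ∑ᶠ u ∈ {u | G.Adj v u}, f u = 0 := by
      apply finsum_mem_eq_zero_of_forall_eq_zero
      intro u hu
      by_contra hne
      exact hno ⟨u, Nat.one_le_iff_ne_zero.mpr hne, SimpleGraph.Adj.symm hu⟩
    unfold closedNbhdSum at h
    omega
  have hi : indepDom G ≤ {v | 1 ≤ f v}.ncard := Nat.sInf_le ⟨_, hS, rfl⟩
  have hcard : {v | 1 ≤ f v}.ncard = {v | f v = k}.ncard + {v | f v = k + 1}.ncard := by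
    rw [← Set.ncard_union_eq]
    · congr 1
      ext v
      have h1 := hlab v
      have h2 := hle v
      simp only [Set.mem_ofPred_eq, Set.mem_union]
      omega
    · rw [Set.disjoint_left]
      intro v h1 h2
      simp only [Set.mem_ofPred_eq] at h1 h2
      omega
  have hw : weight f = k * {v | f v = k}.ncard + (k + 1) * {v | f v = k + 1}.ncard := by
    have e : ∀ j : ℕ, j * {v | f v = j}.ncard = ∑ v, if f v = j then j else 0 := by
      intro j
      rw [← Finset.sum_filter, Finset.sum_const, smul_eq_mul, mul_comm, Set.ncard_eq_toFinset_card']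
      simp
    rw [weight, finsum_eq_sum_of_fintype, e, e, ← Finset.sum_add_distrib]
    apply Finset.sum_congr rfl
    intro v _
    have h1 := hlab v
    have h2 := hle v
    split_ifs <;> omega
  rw [← hmin, hw]
  rw [hcard] at hi
  generalize {v | f v = k}.ncard = a at *
  generalize {v | f v = k + 1}.ncard = b at *
  have hi' : (indepDom G : ℤ) ≤ a + b := by exact_mod_cast hi
  have hk' : (0 : ℤ) ≤ k := by positivity
  push_cast
  constructor <;> nlinarith [mul_le_mul_of_nonneg_left hi' hk']
end KRoman
end
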